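/- arXiv:2409.14053 — 3 statements merged into one kernel-verified Lean document; each statement's English description precedes it below -/
import Mathlib

section
/- Let d ≥ 1, T > 0, and let G : P_2(ℝ^d) → ℝ be Lipschitz continuous with respect to d_1 with constant L_G. Then for every p ≥ 5 there is a constant C_{p,d} > 0, depending only on p and d, such that for all N ≥ 1, t ∈ [0,T) and x ∈ (ℝ^d)^N: V^N(t, x) ≤ U(t, m_x^N) + C_{p,d} L_G ( L_G (T−t) + M_p(m_x^N) ) r_{d,N}, where M_p(ν) := (∫ |x|^p dν(x))^{1/p} and r_{d,N} := N^{−1/4} if d < 4, r_{d,N} := N^{−1/4} (log(1+N))^{1/2} if d = 4, and r_{d,N} := N^{−1/d} if d > 4. -/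
open MeasureTheory Filter
open scoped ENNReal NNReal BigOperators

noncomputable section

/-- `Ed d` is the Euclidean space `ℝ^d`. -/
abbrev Ed (d : ℕ) := EuclideanSpace ℝ (Fin d)

/-- A Borel probability measure on `ℝ^d` with finite second moment,
i.e. an element of `P_2(ℝ^d)`. -/
def IsP2 {d : ℕ} (μ : Measure (Ed d)) : Prop :=
  IsProbabilityMeasure μ ∧ Integrable (fun x => ‖x‖ ^ 2) μ

/-- The empirical measure `m_x^N = (1/N) ∑ δ_{x^i}`. -/
def empMeas {d N : ℕ} (x : Fin N → Ed d) : Measure (Ed d) :=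
  (N : ℝ≥0∞)⁻¹ • ∑ i, Measure.dirac (x i)

/-- `π` is a coupling of `μ` and `ν`. -/
def IsCoupling {d : ℕ} (π : Measure (Ed d × Ed d)) (μ ν : Measure (Ed d)) : Prop :=
  IsProbabilityMeasure π ∧ π.map Prod.fst = μ ∧ π.map Prod.snd = ν

/-- The squared 2-Wasserstein distance `d_2(μ,ν)²`, as the infimum over couplings of
`∫ |x - y|² dπ(x,y)` (with value in `[0,∞]`). -/
def d2sq {d : ℕ} (μ ν : Measure (Ed d)) : ℝ≥0∞ :=
  ⨅ (π : Measure (Ed d × Ed d)) (_ : IsCoupling π μ ν),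
    ∫⁻ p, (‖p.1 - p.2‖₊ : ℝ≥0∞) ^ 2 ∂π

/-- The 2-Wasserstein distance `d_2(μ,ν)`. -/
def d2 {d : ℕ} (μ ν : Measure (Ed d)) : ℝ := Real.sqrt (d2sq μ ν).toReal

/-- The 1-Wasserstein distance, via Kantorovich duality:
`d_1(μ,ν) = sup { ∫ f dμ - ∫ f dν : f 1-Lipschitz }`. -/
def d1 {d : ℕ} (μ ν : Measure (Ed d)) : ℝ :=
  sSup { r | ∃ f : Ed d → ℝ, LipschitzWith 1 f ∧ r = (∫ x, f x ∂μ) - ∫ x, f x ∂ν }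

/-- The Hopf–Lax mean-field value function
`U(t,m) = inf_{ν ∈ P_2} { G(ν) + d_2(m,ν)²/(2(T-t)) }`. -/
def MFval {d : ℕ} (T : ℝ) (G : Measure (Ed d) → ℝ) (t : ℝ) (m : Measure (Ed d)) : ℝ :=
  sInf { r | ∃ ν : Measure (Ed d), IsP2 ν ∧
    r = G ν + (d2sq m ν).toReal / (2 * (T - t)) }

/-- The Hopf–Lax `N`-particle value function
`V^N(t,x) = inf_y { G(m_y^N) + (1/(2(T-t)N)) ∑ |x^i - y^i|² }`. -/
def NPval {d N : ℕ} (T : ℝ) (G : Measure (Ed d) → ℝ) (t : ℝ) (x : Fin N → Ed d) : ℝ :=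
  sInf { r | ∃ y : Fin N → Ed d,
    r = G (empMeas y) + (1 / (2 * (T - t) * (N : ℝ))) * ∑ i, ‖x i - y i‖ ^ 2 }

/-- The `p`-th moment `M_p(ν) = (∫ |x|^p dν)^{1/p}`. -/
def Mp {d : ℕ} (p : ℝ) (ν : Measure (Ed d)) : ℝ := (∫ x, ‖x‖ ^ p ∂ν) ^ (1 / p)

/-- The rate `r_{d,N}`. -/
def rdN (d N : ℕ) : ℝ :=
  if d < 4 then (N : ℝ) ^ (-(1 / 4 : ℝ))
  else if d = 4 then (N : ℝ) ^ (-(1 / 4 : ℝ)) * (Real.log (1 + (N : ℝ))) ^ ((1 : ℝ) / 2)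
  else (N : ℝ) ^ (-(1 / (d : ℝ)))

open ProbabilityTheory in
/-- For independent samples, the expected absolute deviation of the number of hits of a set `A`
from its mean is at most the square root of that mean. -/
lemma integral_abs_count_sub_le {ι E : Type*} [Fintype ι] [MeasurableSpace E]
    (κ : ι → Measure E) [∀ i, IsProbabilityMeasure (κ i)] (I : Finset ι) {A : Set E}
    (hA : MeasurableSet A) :
    Integrable (fun y : ι → E => |∑ i ∈ I, (A.indicator (fun _ => (1 : ℝ)) (y i)
      - (κ i).real A)|) (Measure.pi κ) ∧
    ∫ y, |∑ i ∈ I, (A.indicator (fun _ => (1 : ℝ)) (y i) - (κ i).real A)| ∂(Measure.pi κ)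
      ≤ √(∑ i ∈ I, (κ i).real A) := by
  classical
  set X : (i : ι) → E → ℝ := fun i z =>
    if i ∈ I then A.indicator (fun _ => (1 : ℝ)) z - (κ i).real A else 0 with hX
  have hmem : ∀ i, MemLp (X i) 2 (κ i) := by
    intro i
    by_cases hi : i ∈ I
    · simp only [hX, hi, if_true]
      exact ((memLp_const (1 : ℝ)).indicator hA).sub (memLp_const _)
    · simp [hX, hi]
  have hsum : ∀ y : ι → E, ∑ i ∈ I, (A.indicator (fun _ => (1 : ℝ)) (y i) - (κ i).real A)
      = (∑ i, fun ω : ι → E => X i (ω i)) y := by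
    intro y
    simp [hX, Finset.sum_apply, Finset.sum_ite_mem]
  simp only [hsum]
  set S : (ι → E) → ℝ := ∑ i, fun ω : ι → E => X i (ω i) with hS
  have hSmem : MemLp S 2 (Measure.pi κ) :=
    memLp_finsetSum' _ fun i _ => (hmem i).comp_measurePreserving (measurePreserving_eval _ i)
  have hSint : Integrable S (Measure.pi κ) := hSmem.integrable (by norm_num)
  have hint0 : ∀ i, ∫ z, X i z ∂(κ i) = 0 := by
    intro i
    by_cases hi : i ∈ I
    · simp only [hX, hi, if_true]
      rw [integral_sub ((integrable_const _).indicator hA) (integrable_const _),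
        integral_indicator hA]
      simp
    · simp [hX, hi]
  have hvar : ∀ i, Var[X i; κ i] ≤ if i ∈ I then (κ i).real A else 0 := by
    intro i
    by_cases hi : i ∈ I
    · simp only [hX, hi, if_true]
      rw [variance_sub_const ((measurable_const.indicator hA).aestronglyMeasurable)]
      refine (variance_le_expectation_sq
        ((measurable_const.indicator hA).aestronglyMeasurable)).trans (le_of_eq ?_)
      have : (A.indicator (fun _ => (1 : ℝ))) ^ 2 = A.indicator (fun _ => (1 : ℝ)) := by
        ext z; by_cases hz : z ∈ A <;> simp [hz]
      rw [this, integral_indicator hA]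
      simp
    · have : X i = fun _ => 0 := by ext z; simp [hX, hi]
      rw [this, if_neg hi, show (fun _ : E => (0 : ℝ)) = 0 from rfl, variance_zero]
  have hSvar : ∫ y, S y ^ 2 ∂(Measure.pi κ) ≤ ∑ i ∈ I, (κ i).real A := by
    have hSm : ∫ y, S y ∂(Measure.pi κ) = 0 := by
      have : ∀ y, S y = ∑ i, X i (y i) := fun y => by simp [hS]
      simp only [this]
      have hInt : ∀ i ∈ Finset.univ, Integrable (fun y : ι → E => X i (y i)) (Measure.pi κ) :=
        fun i _ => (measurePreserving_eval κ i).integrable_comp_of_integrable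
          ((hmem i).integrable (by norm_num))
      rw [integral_finsetSum _ hInt]
      refine Finset.sum_eq_zero fun i _ => ?_
      rw [integral_comp_eval (hmem i).aestronglyMeasurable, hint0]
    rw [← variance_of_integral_eq_zero hSmem.aemeasurable hSm, hS, variance_sum_pi hmem]
    refine (Finset.sum_le_sum fun i _ => hvar i).trans (le_of_eq ?_)
    simp
  refine ⟨hSint.abs, Real.le_sqrt_of_sq_le ?_⟩
  have hv := variance_nonneg |S| (Measure.pi κ)
  rw [variance_eq_sub hSmem.abs] at hv
  have : ∫ y, (|S| ^ 2) y ∂(Measure.pi κ) = ∫ y, S y ^ 2 ∂(Measure.pi κ) := by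
    simp [sq_abs]
  rw [this] at hv
  simp only [Pi.abs_apply] at hv
  linarith

/-- Index of the dyadic cube of side `4 * r / 2 ^ l` with corner `(-r, …, -r)` containing `z`. -/
def dyadicKey {d : ℕ} (r : ℝ) (l : ℕ) (z : Ed d) : Fin d → ℕ :=
  fun j => ⌊(2 : ℝ) ^ l * ((z j + r) / (4 * r))⌋₊

/-- The lower corner of the dyadic cube with index `k` at level `l`. -/
def dyadicCorner {d : ℕ} (r : ℝ) (l : ℕ) (k : Fin d → ℕ) : Ed d :=
  WithLp.toLp 2 fun j => 4 * r * (k j : ℝ) / 2 ^ l - r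

lemma norm_le_sqrt_mul_of_abs_le {d : ℕ} {v : Ed d} {a : ℝ} (ha : 0 ≤ a)
    (h : ∀ j, |v j| ≤ a) : ‖v‖ ≤ √d * a := by
  rw [EuclideanSpace.norm_eq, ← Real.sqrt_sq ha, ← Real.sqrt_mul (Nat.cast_nonneg d)]
  refine Real.sqrt_le_sqrt ?_
  have : ∀ j ∈ (Finset.univ : Finset (Fin d)), ‖v j‖ ^ 2 ≤ a ^ 2 := fun j _ => by
    rw [Real.norm_eq_abs]; gcongr; exact h j
  refine (Finset.sum_le_sum this).trans ?_
  simp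

lemma abs_coord_le_norm {d : ℕ} (z : Ed d) (j : Fin d) : |z j| ≤ ‖z‖ := by
  simpa using PiLp.norm_apply_le z j

lemma dyadicKey_succ_div {d : ℕ} (r : ℝ) (l : ℕ) (z : Ed d) :
    (fun j => dyadicKey r (l + 1) z j / 2) = dyadicKey r l z := by
  ext j
  unfold dyadicKey
  have h := Nat.floor_div_natCast ((2 : ℝ) ^ (l + 1) * ((z j + r) / (4 * r))) 2
  rw [← h]
  congr 1
  push_cast
  ring

lemma dyadicKey_lt {d : ℕ} {r : ℝ} (hr : 0 < r) (l : ℕ) {z : Ed d} (hz : ‖z‖ ≤ r) (j : Fin d) :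
    dyadicKey r l z j < 2 ^ l := by
  have h1 := abs_le.1 ((abs_coord_le_norm z j).trans hz)
  unfold dyadicKey
  have h2 : (z j + r) / (4 * r) < 1 := by rw [div_lt_one (by positivity)]; linarith [h1.2]
  have h3 : 0 ≤ (z j + r) / (4 * r) := div_nonneg (by linarith [h1.1]) (by positivity)
  rw [Nat.floor_lt (by positivity)]
  push_cast
  have : (0 : ℝ) < 2 ^ l := by positivity
  nlinarith

lemma dyadicKey_zero {d : ℕ} {r : ℝ} (hr : 0 < r) {z : Ed d} (hz : ‖z‖ ≤ r) :
    dyadicKey r 0 z = 0 := by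
  ext j
  simpa using dyadicKey_lt hr 0 hz j

lemma norm_sub_dyadicCorner_le {d : ℕ} {r : ℝ} (hr : 0 < r) (l : ℕ) {z : Ed d} (hz : ‖z‖ ≤ r) :
    ‖z - dyadicCorner r l (dyadicKey r l z)‖ ≤ √d * (4 * r / 2 ^ l) := by
  refine norm_le_sqrt_mul_of_abs_le (by positivity) fun j => ?_
  have h1 := abs_le.1 ((abs_coord_le_norm z j).trans hz)
  have h3 : 0 ≤ (2 : ℝ) ^ l * ((z j + r) / (4 * r)) :=
    mul_nonneg (by positivity) (div_nonneg (by linarith [h1.1]) (by positivity))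
  have h4 := Nat.floor_le h3
  have h5 := Nat.lt_floor_add_one ((2 : ℝ) ^ l * ((z j + r) / (4 * r)))
  have h6 : (z - dyadicCorner r l (dyadicKey r l z)) j = (4 * r / 2 ^ l) *
      ((2 : ℝ) ^ l * ((z j + r) / (4 * r)) - (⌊(2 : ℝ) ^ l * ((z j + r) / (4 * r))⌋₊ : ℝ)) := by
    simp only [PiLp.sub_apply, dyadicCorner, dyadicKey]
    field_simp
    ring
  rw [h6, abs_of_nonneg (mul_nonneg (by positivity) (by linarith))]
  exact mul_le_of_le_one_right (by positivity) (by linarith)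

lemma norm_dyadicCorner_succ_sub_le {d : ℕ} {r : ℝ} (hr : 0 < r) (l : ℕ) (k : Fin d → ℕ) :
    ‖dyadicCorner r (l + 1) k - dyadicCorner r l (fun j => k j / 2)‖
      ≤ √d * (4 * r / 2 ^ (l + 1)) := by
  refine norm_le_sqrt_mul_of_abs_le (by positivity) fun j => ?_
  have h6 : (dyadicCorner r (l + 1) k - dyadicCorner r l (fun j => k j / 2)) j
      = (4 * r / 2 ^ (l + 1)) * ((k j % 2 : ℕ) : ℝ) := by
    have : (k j : ℝ) = 2 * ((k j / 2 : ℕ) : ℝ) + ((k j % 2 : ℕ) : ℝ) := by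
      exact_mod_cast (Nat.div_add_mod (k j) 2).symm
    simp only [PiLp.sub_apply, dyadicCorner]
    rw [this, pow_succ]
    field_simp
    ring
  rw [h6, abs_of_nonneg (by positivity)]
  refine mul_le_of_le_one_right (by positivity) ?_
  have : k j % 2 ≤ 1 := by omega
  exact Nat.cast_le_one.2 this

lemma measurable_dyadicKey {d : ℕ} (r : ℝ) (l : ℕ) :
    Measurable (dyadicKey r l : Ed d → Fin d → ℕ) := by
  refine measurable_pi_lambda _ fun j => ?_
  refine Nat.measurable_floor.comp ?_
  fun_prop

lemma apply_corner_eq_telescope {d : ℕ} {r : ℝ} (hr : 0 < r) (f : Ed d → ℝ) (L : ℕ) {z : Ed d}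
    (hz : ‖z‖ ≤ r) :
    f (dyadicCorner r L (dyadicKey r L z)) = f (dyadicCorner r 0 0) +
      ∑ l ∈ Finset.range L, ∑ k ∈ Fintype.piFinset fun _ : Fin d => Finset.range (2 ^ (l + 1)),
        (f (dyadicCorner r (l + 1) k) - f (dyadicCorner r l fun j => k j / 2)) *
          (dyadicKey r (l + 1) ⁻¹' {k}).indicator (fun _ => 1) z := by
  have h : ∀ l, ∑ k ∈ Fintype.piFinset fun _ : Fin d => Finset.range (2 ^ (l + 1)),
        (f (dyadicCorner r (l + 1) k) - f (dyadicCorner r l fun j => k j / 2)) *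
          (dyadicKey r (l + 1) ⁻¹' {k}).indicator (fun _ => 1) z
      = f (dyadicCorner r (l + 1) (dyadicKey r (l + 1) z))
        - f (dyadicCorner r l (dyadicKey r l z)) := by
    intro l
    rw [Finset.sum_eq_single (dyadicKey r (l + 1) z)]
    · simp [dyadicKey_succ_div]
    · intro k _ hk
      simp [Set.indicator, hk.symm]
    · intro hk
      refine absurd ?_ hk
      simpa [Fintype.mem_piFinset] using dyadicKey_lt hr (l + 1) hz
  simp only [h]
  rw [Finset.sum_range_sub (fun l => f (dyadicCorner r l (dyadicKey r l z))), dyadicKey_zero hr hz]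
  ring

/-- The dyadic bound on the deviation of the empirical sum from its mean,
uniformly over `1`-Lipschitz functions. -/
def dyadicErr {ι : Type*} {d : ℕ} (κ : ι → Measure (Ed d)) (I : Finset ι) (r : ℝ) (L : ℕ)
    (y : ι → Ed d) : ℝ :=
  (∑ l ∈ Finset.range L, √d * (4 * r / 2 ^ (l + 1)) *
    ∑ k ∈ Fintype.piFinset fun _ : Fin d => Finset.range (2 ^ (l + 1)),
      |∑ i ∈ I, ((dyadicKey r (l + 1) ⁻¹' {k}).indicator (fun _ => (1 : ℝ)) (y i)
        - (κ i).real (dyadicKey r (l + 1) ⁻¹' {k}))|)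
  + 2 * (I.card : ℝ) * (√d * (4 * r / 2 ^ L))

lemma sum_sub_integral_le_dyadicErr {ι : Type*} {d : ℕ} (κ : ι → Measure (Ed d))
    [∀ i, IsProbabilityMeasure (κ i)] (I : Finset ι) {r : ℝ} (hr : 0 < r) (L : ℕ)
    (hκ : ∀ i ∈ I, ∀ᵐ z ∂(κ i), ‖z‖ ≤ r) {y : ι → Ed d} (hy : ∀ i ∈ I, ‖y i‖ ≤ r)
    {f : Ed d → ℝ} (hf : LipschitzWith 1 f) :
    ∑ i ∈ I, (f (y i) - ∫ z, f z ∂(κ i)) ≤ dyadicErr κ I r L y := by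
  set δ := √d * (4 * r / 2 ^ L) with hδ
  set g : ℕ → (Fin d → ℕ) → ℝ := fun l k =>
    f (dyadicCorner r (l + 1) k) - f (dyadicCorner r l fun j => k j / 2) with hg
  set K : ℕ → Finset (Fin d → ℕ) := fun l =>
    Fintype.piFinset fun _ : Fin d => Finset.range (2 ^ (l + 1)) with hK
  set A : ℕ → (Fin d → ℕ) → Set (Ed d) := fun l k => dyadicKey r (l + 1) ⁻¹' {k} with hA
  have hAm : ∀ l k, MeasurableSet (A l k) := fun l k =>
    measurable_dyadicKey r (l + 1) (measurableSet_singleton k)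
  set F : Ed d → ℝ := fun z => f (dyadicCorner r 0 0) +
      ∑ l ∈ Finset.range L, ∑ k ∈ K l, g l k * (A l k).indicator (fun _ => 1) z with hF
  have hclose : ∀ z, ‖z‖ ≤ r → |f z - F z| ≤ δ := by
    intro z hz
    have h := apply_corner_eq_telescope hr f L hz
    have h2 : F z = f (dyadicCorner r L (dyadicKey r L z)) := h.symm
    rw [h2, ← Real.dist_eq]
    refine (hf.dist_le_mul _ _).trans ?_
    rw [NNReal.coe_one, one_mul, dist_eq_norm]
    exact norm_sub_dyadicCorner_le hr L hz
  have hgb : ∀ l k, |g l k| ≤ √d * (4 * r / 2 ^ (l + 1)) := by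
    intro l k
    rw [hg, ← Real.dist_eq]
    refine (hf.dist_le_mul _ _).trans ?_
    rw [NNReal.coe_one, one_mul, dist_eq_norm]
    exact norm_dyadicCorner_succ_sub_le hr l k
  have hterm : ∀ i l k, Integrable (fun z => g l k * (A l k).indicator (fun _ => (1 : ℝ)) z)
      (κ i) := fun i l k => ((integrable_const (1 : ℝ)).indicator (hAm l k)).const_mul _
  have hFint : ∀ i, Integrable F (κ i) := fun i =>
    (integrable_const _).add
      (integrable_finsetSum _ fun l _ => integrable_finsetSum _ fun k _ => hterm i l k)
  have hFval : ∀ i, ∫ z, F z ∂(κ i) = f (dyadicCorner r 0 0) +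
      ∑ l ∈ Finset.range L, ∑ k ∈ K l, g l k * (κ i).real (A l k) := by
    intro i
    rw [hF, integral_add (integrable_const _)
      (integrable_finsetSum _ fun l _ => integrable_finsetSum _ fun k _ => hterm i l k),
      integral_finsetSum _ fun l _ => integrable_finsetSum _ fun k _ => hterm i l k]
    congr 1
    · simp
    · refine Finset.sum_congr rfl fun l _ => ?_
      rw [integral_finsetSum _ fun k _ => hterm i l k]
      refine Finset.sum_congr rfl fun k _ => ?_
      rw [integral_const_mul, integral_indicator (hAm l k)]
      simp
  have hfint : ∀ i ∈ I, Integrable f (κ i) := by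
    intro i hi
    have hb : ∀ᵐ z ∂(κ i), ‖f z - F z‖ ≤ δ := (hκ i hi).mono fun z hz => hclose z hz
    have := (Integrable.of_bound ((hf.continuous.aestronglyMeasurable).sub
      (hFint i).aestronglyMeasurable) δ hb).add (hFint i)
    refine this.congr (Eventually.of_forall fun z => ?_)
    simp
  have hone : ∀ i ∈ I, f (y i) - ∫ z, f z ∂(κ i) ≤ (∑ l ∈ Finset.range L, ∑ k ∈ K l,
      g l k * ((A l k).indicator (fun _ => (1 : ℝ)) (y i) - (κ i).real (A l k))) + 2 * δ := by
    intro i hi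
    have h1 := (abs_le.1 (hclose _ (hy i hi))).2
    have h2 : ∫ z, F z ∂(κ i) ≤ ∫ z, (f z + δ) ∂(κ i) := by
      refine integral_mono_ae (hFint i) ((hfint i hi).add (integrable_const _)) ?_
      filter_upwards [hκ i hi] with z hz
      have := (abs_le.1 (hclose z hz)).1
      linarith
    rw [integral_add (hfint i hi) (integrable_const _), hFval] at h2
    simp only [integral_const, probReal_univ, one_smul] at h2
    simp only [mul_sub, Finset.sum_sub_distrib]
    simp only [hF] at h1
    linarith
  refine (Finset.sum_le_sum hone).trans ?_
  rw [Finset.sum_add_distrib, dyadicErr]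
  refine add_le_add ?_ (le_of_eq (by simp [hδ]; ring))
  rw [Finset.sum_comm]
  refine Finset.sum_le_sum fun l _ => ?_
  rw [Finset.sum_comm, Finset.mul_sum]
  refine Finset.sum_le_sum fun k _ => ?_
  rw [← Finset.mul_sum]
  refine (le_abs_self _).trans ?_
  rw [abs_mul]
  exact mul_le_mul_of_nonneg_right (hgb l k) (abs_nonneg _)

lemma geom_sum_two_div_le {q : ℝ} (hq : 2 ≤ q) (L : ℕ) :
    ∑ l ∈ Finset.range L, q ^ (l + 1) ≤ 2 * q ^ L := by
  induction L with
  | zero => simp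
  | succ n ih =>
    rw [Finset.sum_range_succ]
    have : 0 < q ^ n := by positivity
    rw [pow_succ]
    nlinarith

lemma integral_dyadicErr_le {ι : Type*} [Fintype ι] {d : ℕ} (κ : ι → Measure (Ed d))
    [∀ i, IsProbabilityMeasure (κ i)] (I : Finset ι) {r : ℝ} (hr : 0 < r) (L : ℕ) {D : ℕ}
    (hD : 4 ≤ D) (hdD : d ≤ D) :
    Integrable (dyadicErr κ I r L) (Measure.pi κ) ∧
    ∫ y, dyadicErr κ I r L y ∂(Measure.pi κ) ≤
      8 * √d * r / 2 ^ L * (√((2 : ℝ) ^ (D * L) * I.card) + I.card) := by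
  have hAm : ∀ l k, MeasurableSet (dyadicKey (d := d) r (l + 1) ⁻¹' {k}) := fun l k =>
    measurable_dyadicKey r (l + 1) (measurableSet_singleton k)
  have hi1 : ∀ l k, _ := fun l k => (integral_abs_count_sub_le κ I (hAm l k))
  have hi2 : ∀ l, Integrable (fun y => √d * (4 * r / 2 ^ (l + 1)) *
    ∑ k ∈ Fintype.piFinset fun _ : Fin d => Finset.range (2 ^ (l + 1)),
      |∑ i ∈ I, ((dyadicKey r (l + 1) ⁻¹' {k}).indicator (fun _ => (1 : ℝ)) (y i)
        - (κ i).real (dyadicKey r (l + 1) ⁻¹' {k}))|) (Measure.pi κ) := fun l =>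
    (integrable_finsetSum _ fun k _ => (hi1 l k).1).const_mul _
  have hi3 := integrable_finsetSum (μ := Measure.pi κ) (Finset.range L) fun l _ => hi2 l
  refine ⟨hi3.add (integrable_const _), ?_⟩
  have hlevel : ∀ l, ∑ k ∈ Fintype.piFinset fun _ : Fin d => Finset.range (2 ^ (l + 1)),
      √(∑ i ∈ I, (κ i).real (dyadicKey r (l + 1) ⁻¹' {k}))
      ≤ √((2 : ℝ) ^ (D * (l + 1)) * I.card) := by
    intro l
    set K := Fintype.piFinset fun _ : Fin d => Finset.range (2 ^ (l + 1)) with hK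
    refine Real.le_sqrt_of_sq_le ?_
    refine sq_sum_le_card_mul_sum_sq.trans ?_
    have hcard : (K.card : ℝ) ≤ 2 ^ (D * (l + 1)) := by
      have : K.card = 2 ^ (d * (l + 1)) := by
        simp [hK, Fintype.card_piFinset, ← pow_mul, mul_comm]
      rw [this]
      push_cast
      exact pow_le_pow_right₀ (by norm_num) (Nat.mul_le_mul_right _ hdD)
    refine mul_le_mul hcard ?_ (Finset.sum_nonneg fun _ _ => sq_nonneg _) (by positivity)
    have : ∀ k ∈ K, √(∑ i ∈ I, (κ i).real (dyadicKey r (l + 1) ⁻¹' {k})) ^ 2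
        = ∑ i ∈ I, (κ i).real (dyadicKey r (l + 1) ⁻¹' {k}) := fun k _ =>
      Real.sq_sqrt (Finset.sum_nonneg fun _ _ => measureReal_nonneg)
    rw [Finset.sum_congr rfl this, Finset.sum_comm]
    have h1 : ∀ i ∈ I, ∑ k ∈ K, (κ i).real (dyadicKey r (l + 1) ⁻¹' {k}) ≤ 1 := by
      intro i _
      rw [← measureReal_biUnion_finset
        (fun a _ b _ hab => Disjoint.preimage _ (by simpa using hab)) (fun k _ => hAm l k)]
      exact measureReal_le_one
    refine (Finset.sum_le_sum h1).trans ?_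
    simp
  have hval : ∫ y, dyadicErr κ I r L y ∂(Measure.pi κ) ≤
      (∑ l ∈ Finset.range L, √d * (4 * r / 2 ^ (l + 1)) * √((2 : ℝ) ^ (D * (l + 1)) * I.card))
      + 2 * (I.card : ℝ) * (√d * (4 * r / 2 ^ L)) := by
    unfold dyadicErr
    rw [integral_add hi3 (integrable_const _), integral_finsetSum _ fun l _ => hi2 l]
    refine add_le_add (Finset.sum_le_sum fun l _ => ?_) (by simp)
    rw [integral_const_mul, integral_finsetSum _ fun k _ => (hi1 l k).1]
    refine mul_le_mul_of_nonneg_left ?_ (by positivity)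
    exact (Finset.sum_le_sum fun k _ => (hi1 l k).2).trans (hlevel l)
  refine hval.trans ?_
  set q : ℝ := √(2 ^ D) / 2 with hq
  have hq2 : 2 ≤ q := by
    have : (4 : ℝ) ≤ √(2 ^ D) := by
      refine Real.le_sqrt_of_sq_le ?_
      calc (4 : ℝ) ^ 2 = 2 ^ 4 := by norm_num
        _ ≤ 2 ^ D := pow_le_pow_right₀ (by norm_num) hD
    rw [hq]; linarith
  have hsq : ∀ m : ℕ, √((2 : ℝ) ^ (D * m) * I.card) = 2 ^ m * q ^ m * √I.card := by
    intro m
    have h : √(((2 : ℝ) ^ D) ^ m) = √(2 ^ D) ^ m := by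
      refine (Real.sqrt_eq_iff_eq_sq (by positivity) (by positivity)).2 ?_
      rw [← pow_mul √((2 : ℝ) ^ D), mul_comm m 2, pow_mul √((2 : ℝ) ^ D),
        Real.sq_sqrt (by positivity)]
    rw [Real.sqrt_mul (by positivity), pow_mul, hq, div_pow, h]
    field_simp
  have hsum : ∑ l ∈ Finset.range L, √d * (4 * r / 2 ^ (l + 1)) *
      √((2 : ℝ) ^ (D * (l + 1)) * I.card)
      = √d * (4 * r) * √I.card * ∑ l ∈ Finset.range L, q ^ (l + 1) := by
    rw [Finset.mul_sum]
    refine Finset.sum_congr rfl fun l _ => ?_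
    rw [hsq]
    field_simp
  rw [hsum, hsq]
  have hg := mul_le_mul_of_nonneg_left (geom_sum_two_div_le hq2 L)
    (show 0 ≤ √d * (4 * r) * √I.card by positivity)
  refine (add_le_add_left hg _).trans (le_of_eq ?_)
  field_simp
  ring

lemma exists_integral_dyadicErr_le {ι : Type*} [Fintype ι] {d : ℕ} (κ : ι → Measure (Ed d))
    [∀ i, IsProbabilityMeasure (κ i)] (I : Finset ι) {r : ℝ} (hr : 0 < r) {D : ℕ}
    (hD : 4 ≤ D) (hdD : d ≤ D) :
    ∃ L, Integrable (dyadicErr κ I r L) (Measure.pi κ) ∧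
    ∫ y, dyadicErr κ I r L y ∂(Measure.pi κ) ≤
      32 * √d * r * (I.card : ℝ) ^ (1 - 1 / (D : ℝ)) := by
  have hD0 : (0 : ℝ) < D := by exact_mod_cast (by omega : 0 < D)
  rcases Nat.eq_zero_or_pos I.card with h0 | hpos
  · obtain ⟨h1, h2⟩ := integral_dyadicErr_le κ I hr 0 hD hdD
    refine ⟨0, h1, h2.trans ?_⟩
    rw [h0]
    simp only [Nat.cast_zero, mul_zero, Real.sqrt_zero, add_zero]
    positivity
  · set n := I.card with hn
    set L := Nat.log (2 ^ D) n with hL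
    obtain ⟨h1, h2⟩ := integral_dyadicErr_le κ I hr L hD hdD
    refine ⟨L, h1, h2.trans ?_⟩
    have hb : 1 < 2 ^ D := Nat.one_lt_two_pow (by omega)
    have hn0 : (0 : ℝ) < n := by exact_mod_cast hpos
    have hle : (2 : ℝ) ^ (D * L) ≤ n := by
      rw [pow_mul]
      exact_mod_cast Nat.pow_log_le_self (2 ^ D) hpos.ne'
    have hlt : (n : ℝ) < 2 ^ (D * (L + 1)) := by
      rw [pow_mul]
      exact_mod_cast Nat.lt_pow_succ_log_self hb n
    have hsq : √((2 : ℝ) ^ (D * L) * n) ≤ n := by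
      refine Real.sqrt_le_iff.2 ⟨hn0.le, ?_⟩
      rw [sq]
      exact mul_le_mul_of_nonneg_right hle hn0.le
    have hroot : (n : ℝ) ^ (1 / (D : ℝ)) ≤ 2 ^ (L + 1) := by
      calc (n : ℝ) ^ (1 / (D : ℝ)) ≤ ((2 : ℝ) ^ (D * (L + 1))) ^ (1 / (D : ℝ)) :=
            Real.rpow_le_rpow hn0.le hlt.le (by positivity)
        _ = 2 ^ (L + 1) := by
            rw [mul_comm, pow_mul, one_div, Real.pow_rpow_inv_natCast (by positivity) (by omega)]
    have hsub : (n : ℝ) ^ (1 - 1 / (D : ℝ)) = n / (n : ℝ) ^ (1 / (D : ℝ)) := by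
      rw [Real.rpow_sub hn0, Real.rpow_one]
    have hfin : (n : ℝ) / 2 ^ L ≤ 2 * (n : ℝ) ^ (1 - 1 / (D : ℝ)) := by
      rw [hsub, ← mul_div_assoc, div_le_div_iff₀ (by positivity) (by positivity)]
      rw [pow_succ] at hroot
      nlinarith
    calc 8 * √d * r / 2 ^ L * (√((2 : ℝ) ^ (D * L) * n) + n)
        ≤ 8 * √d * r / 2 ^ L * (n + n) := by gcongr
      _ = 16 * √d * r * (n / 2 ^ L) := by ring
      _ ≤ 16 * √d * r * (2 * (n : ℝ) ^ (1 - 1 / (D : ℝ))) := by gcongr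
      _ = _ := by ring

lemma exists_two_pow_mul_between {s S : ℝ} (hs : 0 ≤ s) (hS : 0 < S) :
    ∃ k : ℕ, s ≤ 2 ^ k * S ∧ 2 ^ k * S ≤ 2 * s + S := by
  rcases le_or_gt s S with h | h
  · exact ⟨0, by simpa using h, by simp; linarith⟩
  · obtain ⟨n, h1, h2⟩ := exists_nat_pow_near (x := s / S) (y := 2)
      ((one_le_div hS).2 h.le) (by norm_num)
    rw [le_div_iff₀ hS] at h1
    rw [div_lt_iff₀ hS] at h2
    exact ⟨n + 1, h2.le, by rw [pow_succ]; linarith⟩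

lemma sum_quarter_pow_le (K : ℕ) : ∑ m ∈ Finset.range K, (1 / 4 : ℝ) ^ m ≤ 2 := by
  have h : ∑ m ∈ Finset.range K, (1 / 4 : ℝ) ^ m = 4 / 3 * (1 - (1 / 4) ^ K) := by
    rw [geom_sum_eq (by norm_num)]
    ring
  have : (0 : ℝ) ≤ (1 / 4) ^ K := by positivity
  linarith

/-- Expected uniform deviation over `1`-Lipschitz functions for independent samples whose
supports have controlled fourth moments. -/
lemma exists_uniform_deviation_bound {ι : Type*} [Fintype ι] [Nonempty ι] {d : ℕ}
    (κ : ι → Measure (Ed d)) [∀ i, IsProbabilityMeasure (κ i)] {s : ι → ℝ} (hs : ∀ i, 0 ≤ s i)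
    {S : ℝ} (hS : 0 < S) (hsS : ∑ i, s i ^ 4 ≤ Fintype.card ι * S ^ 4)
    (hκ : ∀ i, ∀ᵐ z ∂(κ i), ‖z‖ ≤ s i) {D : ℕ} (hD : 4 ≤ D) (hdD : d ≤ D) :
    ∃ Err : (ι → Ed d) → ℝ, Integrable Err (Measure.pi κ) ∧
      ∫ y, Err y ∂(Measure.pi κ) ≤ 8704 * √d * S * (Fintype.card ι : ℝ) ^ (1 - 1 / (D : ℝ)) ∧
      ∀ y : ι → Ed d, (∀ i, ‖y i‖ ≤ s i) → ∀ f : Ed d → ℝ, LipschitzWith 1 f →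
        ∑ i, (f (y i) - ∫ z, f z ∂(κ i)) ≤ Err y := by
  classical
  choose k hk1 hk2 using fun i => exists_two_pow_mul_between (hs i) hS
  set K := Finset.univ.sup k + 1 with hK
  have hkK : ∀ i ∈ Finset.univ, k i ∈ Finset.range K := fun i hi =>
    Finset.mem_range.2 (Nat.lt_succ_iff.2 (Finset.le_sup hi))
  set I : ℕ → Finset ι := fun m => Finset.univ.filter fun i => k i = m with hI
  have hr : ∀ m : ℕ, 0 < 2 ^ m * S := fun m => by positivity
  choose L hL1 hL2 using fun m => exists_integral_dyadicErr_le κ (I m) (hr m) hD hdD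
  refine ⟨fun y => ∑ m ∈ Finset.range K, dyadicErr κ (I m) (2 ^ m * S) (L m) y,
    integrable_finsetSum _ fun m _ => hL1 m, ?_, ?_⟩
  · rw [integral_finsetSum _ fun m _ => hL1 m]
    set n : ℝ := (Fintype.card ι : ℝ) with hn
    have hn0 : 0 < n := by rw [hn]; exact_mod_cast Fintype.card_pos
    have hcard : ∀ m, ((I m).card : ℝ) * 16 ^ m ≤ 136 * n := by
      intro m
      have h1 : ∀ i ∈ I m, (2 ^ m * S) ^ 4 ≤ (2 * s i + S) ^ 4 := by
        intro i hi
        have : k i = m := by simpa [hI] using hi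
        have h := hk2 i
        rw [this] at h
        exact pow_le_pow_left₀ (hr m).le h 4
      have h2 : ((I m).card : ℝ) * (2 ^ m * S) ^ 4 ≤ ∑ i, (2 * s i + S) ^ 4 := by
        calc ((I m).card : ℝ) * (2 ^ m * S) ^ 4 = ∑ i ∈ I m, (2 ^ m * S) ^ 4 := by simp
          _ ≤ ∑ i ∈ I m, (2 * s i + S) ^ 4 := Finset.sum_le_sum h1
          _ ≤ _ := Finset.sum_le_sum_of_subset_of_nonneg (Finset.subset_univ _)
              fun i _ _ => by have := hs i; positivity
      have h3 : ∑ i, (2 * s i + S) ^ 4 ≤ ∑ i, (128 * s i ^ 4 + 8 * S ^ 4) := by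
        refine Finset.sum_le_sum fun i _ => ?_
        have := add_pow_le (a := 2 * s i) (b := S) (by have := hs i; positivity) hS.le 4
        refine this.trans (le_of_eq ?_)
        norm_num
        ring
      have h4 : ∑ i, (128 * s i ^ 4 + 8 * S ^ 4) ≤ 136 * n * S ^ 4 := by
        rw [Finset.sum_add_distrib, ← Finset.mul_sum]
        simp only [Finset.sum_const, Finset.card_univ, nsmul_eq_mul]
        rw [← hn]
        nlinarith
      have h5 := (h2.trans h3).trans h4
      have h6 : (2 ^ m * S) ^ 4 = 16 ^ m * S ^ 4 := by
        rw [mul_pow, ← pow_mul, mul_comm m 4, pow_mul]; norm_num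
      rw [h6, ← mul_assoc] at h5
      exact le_of_mul_le_mul_right h5 (by positivity)
    have hterm : ∀ m, 32 * √d * (2 ^ m * S) * ((I m).card : ℝ) ^ (1 - 1 / (D : ℝ))
        ≤ 4352 * √d * S * n ^ (1 - 1 / (D : ℝ)) * (1 / 4) ^ m := by
      intro m
      set u : ℝ := (I m).card / n with hu
      have hu0 : 0 ≤ u := by positivity
      have hu1 : u ≤ 1 := by
        rw [hu, div_le_one hn0, hn]
        exact_mod_cast Finset.card_le_univ _
      have hu2 : u ≤ 136 * (1 / 16) ^ m := by
        rw [hu, div_le_iff₀ hn0, one_div, inv_pow, mul_assoc, mul_comm _ n, ← mul_assoc,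
          ← div_eq_mul_inv, le_div_iff₀ (by positivity)]
        exact hcard m
      have hDinv : 1 / (D : ℝ) ≤ 1 / 4 :=
        one_div_le_one_div_of_le (by norm_num) (by exact_mod_cast hD)
      have hu3 : u ^ (1 - 1 / (D : ℝ)) ≤ 136 * (1 / 8) ^ m := by
        calc u ^ (1 - 1 / (D : ℝ)) ≤ u ^ (3 / 4 : ℝ) :=
              Real.rpow_le_rpow_of_exponent_ge' hu0 hu1 (by norm_num) (by linarith)
          _ ≤ (136 * (1 / 16) ^ m) ^ (3 / 4 : ℝ) :=
              Real.rpow_le_rpow hu0 hu2 (by norm_num)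
          _ = 136 ^ (3 / 4 : ℝ) * (1 / 8) ^ m := by
              rw [Real.mul_rpow (by norm_num) (by positivity), ← Real.rpow_natCast (1 / 16) m,
                ← Real.rpow_mul (by norm_num), mul_comm (m : ℝ), Real.rpow_mul (by norm_num),
                Real.rpow_natCast]
              congr 2
              rw [show (1 / 16 : ℝ) = (1 / 2) ^ (4 : ℝ) by norm_num,
                ← Real.rpow_mul (by norm_num)]
              norm_num
          _ ≤ 136 ^ (1 : ℝ) * (1 / 8) ^ m := by
              gcongr
              · norm_num
              · norm_num
          _ = _ := by rw [Real.rpow_one]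
      have hI' : ((I m).card : ℝ) = n * u := by rw [hu]; field_simp
      rw [hI', Real.mul_rpow hn0.le hu0]
      calc 32 * √d * (2 ^ m * S) * (n ^ (1 - 1 / (D : ℝ)) * u ^ (1 - 1 / (D : ℝ)))
          ≤ 32 * √d * (2 ^ m * S) * (n ^ (1 - 1 / (D : ℝ)) * (136 * (1 / 8) ^ m)) := by gcongr
        _ = 4352 * √d * S * n ^ (1 - 1 / (D : ℝ)) * (2 ^ m * (1 / 8) ^ m) := by ring
        _ = _ := by rw [← mul_pow]; norm_num
    calc _ ≤ ∑ m ∈ Finset.range K, 4352 * √d * S * n ^ (1 - 1 / (D : ℝ)) * (1 / 4) ^ m :=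
          Finset.sum_le_sum fun m _ => (hL2 m).trans (hterm m)
      _ = 4352 * √d * S * n ^ (1 - 1 / (D : ℝ)) * ∑ m ∈ Finset.range K, (1 / 4) ^ m := by
          rw [Finset.mul_sum]
      _ ≤ 4352 * √d * S * n ^ (1 - 1 / (D : ℝ)) * 2 := by
          gcongr; exact sum_quarter_pow_le K
      _ = _ := by ring
  · intro y hy f hf
    rw [← Finset.sum_fiberwise_of_maps_to hkK]
    refine Finset.sum_le_sum fun m _ => ?_
    have him : ∀ i ∈ I m, s i ≤ 2 ^ m * S := by
      intro i hi
      have : k i = m := by simpa [hI] using hi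
      exact this ▸ hk1 i
    exact sum_sub_integral_le_dyadicErr κ (I m) (hr m) (L m)
      (fun i hi => (hκ i).mono fun z hz => hz.trans (him i hi))
      (fun i hi => (hy i).trans (him i hi)) hf

/-- Radial projection of `z` onto the closed ball of radius `R` around `x`. -/
def radialTrunc {d : ℕ} (R : ℝ) (x z : Ed d) : Ed d := x + min 1 (R / ‖z - x‖) • (z - x)

lemma measurable_radialTrunc {d : ℕ} (R : ℝ) (x : Ed d) : Measurable (radialTrunc R x) := by
  unfold radialTrunc
  fun_prop

lemma radialTrunc_of_le {d : ℕ} {R : ℝ} {x z : Ed d} (h : ‖z - x‖ ≤ R) :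
    radialTrunc R x z = z := by
  unfold radialTrunc
  rcases (norm_nonneg (z - x)).eq_or_lt with h0 | h0
  · have h1 : z - x = 0 := norm_eq_zero.1 h0.symm
    rw [h1, smul_zero, add_zero]
    exact (sub_eq_zero.1 h1).symm
  · rw [min_eq_left ((one_le_div h0).2 h), one_smul]
    abel

lemma norm_radialTrunc_sub_of_lt {d : ℕ} {R : ℝ} (hR : 0 < R) {x z : Ed d} (h : R < ‖z - x‖) :
    ‖radialTrunc R x z - x‖ = R ∧ ‖radialTrunc R x z - z‖ = ‖z - x‖ - R := by
  have h0 : 0 < ‖z - x‖ := hR.trans h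
  have hlt : R / ‖z - x‖ ≤ 1 := (div_le_one h0).2 h.le
  unfold radialTrunc
  rw [min_eq_right hlt]
  constructor
  · rw [add_sub_cancel_left, norm_smul, Real.norm_of_nonneg (by positivity)]
    field_simp
  · have : x + (R / ‖z - x‖) • (z - x) - z = (R / ‖z - x‖ - 1) • (z - x) := by
      rw [sub_smul, one_smul]; abel
    rw [this, norm_smul, Real.norm_of_nonpos (by linarith)]
    field_simp
    ring

lemma norm_radialTrunc_sub_le {d : ℕ} {R : ℝ} (hR : 0 < R) (x z : Ed d) :
    ‖radialTrunc R x z - x‖ ≤ R := by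
  rcases le_or_gt ‖z - x‖ R with h | h
  · rwa [radialTrunc_of_le h]
  · exact (norm_radialTrunc_sub_of_lt hR h).1.le

lemma sq_norm_radialTrunc_add_le {d : ℕ} {R : ℝ} (hR : 0 < R) (x z : Ed d) :
    ‖x - radialTrunc R x z‖ ^ 2 + 2 * R * ‖radialTrunc R x z - z‖ ≤ ‖x - z‖ ^ 2 := by
  rcases le_or_gt ‖z - x‖ R with h | h
  · simp [radialTrunc_of_le h]
  · obtain ⟨h1, h2⟩ := norm_radialTrunc_sub_of_lt hR h
    rw [norm_sub_rev x, norm_sub_rev x, h1, h2]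
    nlinarith [sq_nonneg (‖z - x‖ - R)]

lemma isProbabilityMeasure_empMeas {d N : ℕ} (hN : 1 ≤ N) (x : Fin N → Ed d) :
    IsProbabilityMeasure (empMeas x) := by
  constructor
  simp only [empMeas, Measure.smul_apply, Measure.finsetSum_apply, measure_univ,
    Finset.sum_const, Finset.card_univ, Fintype.card_fin, smul_eq_mul, nsmul_eq_mul, mul_one]
  exact ENNReal.inv_mul_cancel (by simpa using (by omega : N ≠ 0)) (by simp)

lemma integrable_average {E : Type*} [MeasurableSpace E] {N : ℕ} (hN : 1 ≤ N)
    {κ : Fin N → Measure E} {f : E → ℝ} (hf : ∀ i, Integrable f (κ i)) :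
    Integrable f ((N : ℝ≥0∞)⁻¹ • ∑ i, κ i) := by
  refine Integrable.smul_measure ?_ (by simpa using (by omega : N ≠ 0))
  exact integrable_finsetSum_measure.2 fun i _ => hf i

lemma integral_average {E : Type*} [MeasurableSpace E] {N : ℕ}
    {κ : Fin N → Measure E} {f : E → ℝ} (hf : ∀ i, Integrable f (κ i)) :
    ∫ z, f z ∂((N : ℝ≥0∞)⁻¹ • ∑ i, κ i) = (N : ℝ)⁻¹ * ∑ i, ∫ z, f z ∂(κ i) := by
  rw [integral_smul_measure, integral_finsetSum_measure fun i _ => hf i]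
  simp

lemma integral_empMeas {d N : ℕ} (x : Fin N → Ed d) (f : Ed d → ℝ) :
    ∫ z, f z ∂(empMeas x) = (N : ℝ)⁻¹ * ∑ i, f (x i) := by
  rw [empMeas, integral_average fun i => integrable_dirac (by simp)]
  simp

lemma isP2_empMeas {d N : ℕ} (hN : 1 ≤ N) (x : Fin N → Ed d) : IsP2 (empMeas x) :=
  ⟨isProbabilityMeasure_empMeas hN x, integrable_average hN fun i => integrable_dirac (by simp)⟩

lemma d1_le {d : ℕ} {μ ν : Measure (Ed d)} {a : ℝ}
    (h : ∀ f : Ed d → ℝ, LipschitzWith 1 f → (∫ z, f z ∂μ) - ∫ z, f z ∂ν ≤ a) : d1 μ ν ≤ a := by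
  refine csSup_le ⟨_, fun _ => 0, (LipschitzWith.const 0).weaken zero_le_one, rfl⟩ ?_
  rintro r ⟨f, hf, rfl⟩
  exact h f hf

lemma sum_pow_four_le_Mp {d N : ℕ} (hN : 1 ≤ N) {p : ℝ} (hp : 4 ≤ p) (x : Fin N → Ed d)
    {R : ℝ} (hR : 0 ≤ R) :
    0 ≤ Mp p (empMeas x) ∧
    ∑ i, (‖x i‖ + R) ^ 4 ≤ N * (2 * (Mp p (empMeas x) + R)) ^ 4 := by
  have hN0 : (0 : ℝ) < N := by exact_mod_cast hN
  set A : ℝ := (N : ℝ)⁻¹ * ∑ i, ‖x i‖ ^ p with hA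
  have hA0 : 0 ≤ A := by positivity
  have hM : Mp p (empMeas x) = A ^ (1 / p) := by rw [Mp, integral_empMeas]
  set M := Mp p (empMeas x) with hMdef
  have hM0 : 0 ≤ M := by rw [hM]; positivity
  refine ⟨hM0, ?_⟩
  have h4 : (N : ℝ)⁻¹ * ∑ i, ‖x i‖ ^ 4 ≤ M ^ 4 := by
    have hJ := Real.rpow_arith_mean_le_arith_mean_rpow Finset.univ
      (fun _ : Fin N => (N : ℝ)⁻¹) (fun i => ‖x i‖ ^ 4) (fun _ _ => by positivity)
      (by simp [hN0.ne']) (fun _ _ => by positivity) (p := p / 4) (by linarith)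
    have hpow : ∀ i, (‖x i‖ ^ 4) ^ (p / 4) = ‖x i‖ ^ p := by
      intro i
      rw [← Real.rpow_natCast, ← Real.rpow_mul (norm_nonneg _)]
      congr 1
      push_cast
      ring
    simp only [hpow, ← Finset.mul_sum] at hJ
    have hMp : M ^ 4 = A ^ (4 / p) := by
      rw [hM, ← Real.rpow_natCast, ← Real.rpow_mul hA0]
      congr 1
      push_cast
      ring
    rw [hMp]
    have := Real.rpow_le_rpow (by positivity) hJ (show 0 ≤ 4 / p by positivity)
    rw [← Real.rpow_mul (by positivity)] at this
    have h1 : p / 4 * (4 / p) = 1 := by field_simp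
    rwa [h1, Real.rpow_one] at this
  have hs : ∑ i, ‖x i‖ ^ 4 ≤ N * M ^ 4 := by
    rwa [inv_mul_le_iff₀ hN0] at h4
  calc ∑ i, (‖x i‖ + R) ^ 4 ≤ ∑ i, (8 * ‖x i‖ ^ 4 + 8 * R ^ 4) := by
        refine Finset.sum_le_sum fun i _ => ?_
        refine (add_pow_le (norm_nonneg _) hR 4).trans (le_of_eq ?_)
        norm_num
        ring
    _ = 8 * ∑ i, ‖x i‖ ^ 4 + N * (8 * R ^ 4) := by
        rw [Finset.sum_add_distrib, ← Finset.mul_sum]; simp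
    _ ≤ 8 * (N * M ^ 4) + N * (8 * R ^ 4) := by gcongr
    _ = N * (8 * (M ^ 4 + R ^ 4)) := by ring
    _ ≤ N * (16 * (M + R) ^ 4) := by
        have h0 : 0 ≤ M * R := by positivity
        have h1 : M ^ 4 + R ^ 4 ≤ (M + R) ^ 4 := by
          nlinarith [mul_nonneg h0 (sq_nonneg M), mul_nonneg h0 (sq_nonneg R), mul_nonneg h0 h0]
        have h2 : 0 ≤ (M + R) ^ 4 := by positivity
        refine mul_le_mul_of_nonneg_left ?_ hN0.le
        linarith
    _ = _ := by ring

lemma integrable_norm_sub_sq {d : ℕ} {μ : Measure (Ed d)} [IsProbabilityMeasure μ] (x : Ed d)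
    (h : Integrable (fun z => ‖x - z‖ ^ 2) μ) : Integrable (fun z => ‖x - z‖) μ := by
  have : MemLp (fun z => x - z) 2 μ :=
    (memLp_two_iff_integrable_sq_norm (by fun_prop)).2 h
  exact (this.integrable (by norm_num)).norm

lemma LipschitzWith.integrable_of_integrable_norm_sub {d : ℕ} {μ : Measure (Ed d)}
    [IsProbabilityMeasure μ] {x : Ed d} (h : Integrable (fun z => ‖x - z‖) μ) {f : Ed d → ℝ}
    (hf : LipschitzWith 1 f) : Integrable f μ := by
  refine ((integrable_const |f x|).add h).mono' hf.continuous.aestronglyMeasurable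
    (Eventually.of_forall fun z => ?_)
  have h1 := hf.dist_le_mul z x
  rw [NNReal.coe_one, one_mul, dist_eq_norm, dist_eq_norm, norm_sub_rev z x] at h1
  have h2 := norm_le_norm_add_norm_sub' (f z) (f x)
  simp only [Pi.add_apply]
  rw [Real.norm_eq_abs (f x)] at h2
  linarith

/-- Independent sampling from the truncated conditional laws `κ i` produces an `N`-point
configuration whose cost is close to that of the mean-field competitor `(1/N) ∑ κ i`. -/
lemma exists_particles_cost_le {d N : ℕ} (hN : 1 ≤ N) {D : ℕ} (hD : 4 ≤ D) (hdD : d ≤ D)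
    {p : ℝ} (hp : 4 ≤ p) {G : Measure (Ed d) → ℝ} {LG τ R : ℝ}
    (hG : ∀ μ ν : Measure (Ed d), IsP2 μ → IsP2 ν → |G μ - G ν| ≤ LG * d1 μ ν)
    (hLG : 0 ≤ LG) (hτ : 0 < τ) (hR : 0 < R) (hRτ : LG * τ ≤ R) (x : Fin N → Ed d)
    (κ : Fin N → Measure (Ed d)) [∀ i, IsProbabilityMeasure (κ i)]
    (hκ : ∀ i, Integrable (fun z => ‖x i - z‖ ^ 2) (κ i))
    (hν : IsP2 ((N : ℝ≥0∞)⁻¹ • ∑ i, κ i)) :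
    ∃ y : Fin N → Ed d,
      G (empMeas y) + (1 / (2 * τ * (N : ℝ))) * ∑ i, ‖x i - y i‖ ^ 2 ≤
        G ((N : ℝ≥0∞)⁻¹ • ∑ i, κ i)
          + (1 / (2 * τ * (N : ℝ))) * ∑ i, ∫ z, ‖x i - z‖ ^ 2 ∂(κ i)
          + LG * (17408 * √d * (Mp p (empMeas x) + R) * (N : ℝ) ^ (-(1 / (D : ℝ)))) := by
  have hN0 : (0 : ℝ) < N := by exact_mod_cast hN
  have : Nonempty (Fin N) := ⟨⟨0, hN⟩⟩
  have hTm : ∀ i, Measurable (radialTrunc R (x i)) := fun i => measurable_radialTrunc R (x i)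
  set κ' : Fin N → Measure (Ed d) := fun i => (κ i).map (radialTrunc R (x i)) with hκ'
  have : ∀ i, IsProbabilityMeasure (κ' i) := fun i =>
    Measure.isProbabilityMeasure_map (hTm i).aemeasurable
  have hball : ∀ i, ∀ᵐ z ∂(κ' i), ‖z - x i‖ ≤ R := by
    intro i
    rw [hκ', ae_map_iff (hTm i).aemeasurable (measurableSet_le (by fun_prop) (by fun_prop))]
    exact Eventually.of_forall fun z => norm_radialTrunc_sub_le hR _ _
  obtain ⟨hM0, hM4⟩ := sum_pow_four_le_Mp hN hp x hR.le
  set M := Mp p (empMeas x) with hM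
  have hball' : ∀ i (z : Ed d), ‖z - x i‖ ≤ R → ‖z‖ ≤ ‖x i‖ + R := by
    intro i z hz
    have := norm_le_norm_add_norm_sub' z (x i)
    linarith
  obtain ⟨Err, hE1, hE2, hE3⟩ := exists_uniform_deviation_bound κ'
    (s := fun i => ‖x i‖ + R) (fun i => by positivity) (S := 2 * (M + R)) (by positivity)
    (by simpa using hM4) (fun i => (hball i).mono (hball' i)) hD hdD
  rw [Fintype.card_fin] at hE2
  have hsq : ∀ i, Integrable (fun z => ‖x i - z‖ ^ 2) (κ' i) := by
    intro i
    refine Integrable.of_bound (by fun_prop) (R ^ 2) ?_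
    filter_upwards [hball i] with z hz
    rw [Real.norm_of_nonneg (by positivity), norm_sub_rev]
    gcongr
  have hsq' : ∀ i ∈ Finset.univ, Integrable (fun y : Fin N → Ed d => ‖x i - y i‖ ^ 2)
      (Measure.pi κ') := fun i _ =>
    (measurePreserving_eval κ' i).integrable_comp_of_integrable (hsq i)
  have hΦ1 : Integrable (fun y => LG * ((N : ℝ)⁻¹ * Err y)) (Measure.pi κ') :=
    (hE1.const_mul _).const_mul _
  have hΦ2 : Integrable (fun y : Fin N → Ed d =>
      (1 / (2 * τ * (N : ℝ))) * ∑ i, ‖x i - y i‖ ^ 2) (Measure.pi κ') :=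
    (integrable_finsetSum _ hsq').const_mul _
  have hnull : (Measure.pi κ') {y | ¬ ∀ i, ‖y i - x i‖ ≤ R} = 0 := by
    rw [← ae_iff, ae_all_iff]
    exact fun i => (measurePreserving_eval κ' i).quasiMeasurePreserving.ae (hball i)
  obtain ⟨y, hy, hyle⟩ := exists_notMem_null_le_integral (hΦ1.add hΦ2) hnull
  have hy' : ∀ i, ‖y i - x i‖ ≤ R := by simpa using hy
  refine ⟨y, ?_⟩
  have hev : ∀ i, ∫ y : Fin N → Ed d, ‖x i - y i‖ ^ 2 ∂(Measure.pi κ')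
      = ∫ z, ‖x i - radialTrunc R (x i) z‖ ^ 2 ∂(κ i) := by
    intro i
    rw [← integral_map (hTm i).aemeasurable (f := fun z => ‖x i - z‖ ^ 2) (by fun_prop)]
    exact integral_comp_eval (μ := κ') (i := i) (f := fun z => ‖x i - z‖ ^ 2) (by fun_prop)
  have hInt : ∫ y, (LG * ((N : ℝ)⁻¹ * Err y) +
      (1 / (2 * τ * (N : ℝ))) * ∑ i, ‖x i - y i‖ ^ 2) ∂(Measure.pi κ')
      = LG * ((N : ℝ)⁻¹ * ∫ y, Err y ∂(Measure.pi κ')) +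
        (1 / (2 * τ * (N : ℝ))) * ∑ i, ∫ z, ‖x i - radialTrunc R (x i) z‖ ^ 2 ∂(κ i) := by
    rw [integral_add hΦ1 hΦ2, integral_const_mul, integral_const_mul, integral_const_mul,
      integral_finsetSum _ hsq']
    simp only [hev]
  simp only [Pi.add_apply] at hyle
  rw [hInt] at hyle
  have hn1 : ∀ i, Integrable (fun z => ‖x i - z‖) (κ i) := fun i =>
    integrable_norm_sub_sq (x i) (hκ i)
  have hT1 : ∀ i, Integrable (fun z => ‖radialTrunc R (x i) z - z‖) (κ i) := by
    intro i
    refine ((integrable_const R).add (hn1 i)).mono'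
      (((hTm i).sub measurable_id).norm.aestronglyMeasurable) (Eventually.of_forall fun z => ?_)
    rw [norm_norm]
    have h1 := norm_radialTrunc_sub_le hR (x i) z
    have h2 := norm_sub_le_norm_sub_add_norm_sub (radialTrunc R (x i) z) (x i) z
    simp only [Pi.add_apply]
    linarith
  have hT2 : ∀ i, Integrable (fun z => ‖x i - radialTrunc R (x i) z‖ ^ 2) (κ i) := by
    intro i
    refine (hκ i).mono' (((measurable_const.sub (hTm i)).norm.pow_const 2).aestronglyMeasurable)
      (Eventually.of_forall fun z => ?_)
    rw [Real.norm_of_nonneg (by positivity)]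
    have := sq_norm_radialTrunc_add_le hR (x i) z
    have : 0 ≤ 2 * R * ‖radialTrunc R (x i) z - z‖ := by positivity
    linarith
  set δ : ℝ := (N : ℝ)⁻¹ * ∑ i, ∫ z, ‖radialTrunc R (x i) z - z‖ ∂(κ i) with hδ
  have hd1 : d1 (empMeas y) ((N : ℝ≥0∞)⁻¹ • ∑ i, κ i) ≤ (N : ℝ)⁻¹ * Err y + δ := by
    refine d1_le fun f hf => ?_
    have hfi : ∀ i, Integrable f (κ i) := fun i => hf.integrable_of_integrable_norm_sub (hn1 i)
    have hfT : ∀ i, Integrable (fun z => f (radialTrunc R (x i) z)) (κ i) := by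
      intro i
      refine ((hfi i).abs.add (hT1 i)).mono'
        ((hf.continuous.measurable.comp (hTm i)).aestronglyMeasurable)
        (Eventually.of_forall fun z => ?_)
      have h1 := hf.dist_le_mul (radialTrunc R (x i) z) z
      rw [NNReal.coe_one, one_mul, dist_eq_norm, dist_eq_norm] at h1
      have h2 := norm_le_norm_add_norm_sub' (f (radialTrunc R (x i) z)) (f z)
      simp only [Pi.add_apply]
      rw [Real.norm_eq_abs (f z)] at h2
      linarith
    rw [integral_empMeas, integral_average hfi, ← mul_sub, hδ, ← mul_add]
    refine mul_le_mul_of_nonneg_left ?_ (by positivity)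
    have h3 := hE3 y (fun i => hball' i _ (hy' i)) f hf
    have h4 : ∀ i, ∫ z, f z ∂(κ' i) = ∫ z, f (radialTrunc R (x i) z) ∂(κ i) := fun i =>
      integral_map (hTm i).aemeasurable hf.continuous.aestronglyMeasurable
    have h5 : ∀ i ∈ Finset.univ, (∫ z, f (radialTrunc R (x i) z) ∂(κ i)) - ∫ z, f z ∂(κ i)
        ≤ ∫ z, ‖radialTrunc R (x i) z - z‖ ∂(κ i) := by
      intro i _
      rw [← integral_sub (hfT i) (hfi i)]
      refine integral_mono ((hfT i).sub (hfi i)) (hT1 i) fun z => ?_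
      have h1 := hf.dist_le_mul (radialTrunc R (x i) z) z
      rw [NNReal.coe_one, one_mul, dist_eq_norm, dist_eq_norm] at h1
      exact (Real.le_norm_self _).trans h1
    have h6 := Finset.sum_le_sum h5
    simp only [h4, Finset.sum_sub_distrib] at h3 h6
    linarith
  have hGy : G (empMeas y) ≤ G ((N : ℝ≥0∞)⁻¹ • ∑ i, κ i) + LG * ((N : ℝ)⁻¹ * Err y + δ) := by
    have h1 := (abs_le.1 (hG (empMeas y) _ (isP2_empMeas hN y) hν)).2
    have h2 := mul_le_mul_of_nonneg_left hd1 hLG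
    linarith
  have hcost : (1 / (2 * τ * (N : ℝ))) * ∑ i, ∫ z, ‖x i - radialTrunc R (x i) z‖ ^ 2 ∂(κ i)
      + LG * δ ≤ (1 / (2 * τ * (N : ℝ))) * ∑ i, ∫ z, ‖x i - z‖ ^ 2 ∂(κ i) := by
    have h1 : LG * δ ≤ (1 / (2 * τ * (N : ℝ))) *
        ∑ i, 2 * R * ∫ z, ‖radialTrunc R (x i) z - z‖ ∂(κ i) := by
      have hδ0 : 0 ≤ ∑ i, ∫ z, ‖radialTrunc R (x i) z - z‖ ∂(κ i) :=
        Finset.sum_nonneg fun i _ => integral_nonneg fun z => norm_nonneg _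
      have h2 : LG ≤ R / τ := (le_div_iff₀ hτ).2 hRτ
      have h3 : 0 ≤ δ := mul_nonneg (by positivity) hδ0
      refine (mul_le_mul_of_nonneg_right h2 h3).trans (le_of_eq ?_)
      rw [← Finset.mul_sum, hδ]
      field_simp
    refine (add_le_add_right h1 _).trans ?_
    rw [← mul_add, ← Finset.sum_add_distrib]
    refine mul_le_mul_of_nonneg_left (Finset.sum_le_sum fun i _ => ?_) (by positivity)
    rw [← integral_const_mul, ← integral_add (hT2 i) ((hT1 i).const_mul _)]
    exact integral_mono ((hT2 i).add ((hT1 i).const_mul _)) (hκ i)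
      fun z => sq_norm_radialTrunc_add_le hR (x i) z
  have hErr : LG * ((N : ℝ)⁻¹ * ∫ y, Err y ∂(Measure.pi κ')) ≤
      LG * (17408 * √d * (M + R) * (N : ℝ) ^ (-(1 / (D : ℝ)))) := by
    refine mul_le_mul_of_nonneg_left ?_ hLG
    rw [inv_mul_le_iff₀ hN0]
    refine hE2.trans (le_of_eq ?_)
    rw [sub_eq_add_neg, Real.rpow_add hN0, Real.rpow_one]
    ring
  linarith

/-- Disintegration of a coupling whose first marginal is an empirical measure. -/
lemma IsCoupling.exists_average {d N : ℕ} {x : Fin N → Ed d} {ν : Measure (Ed d)}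
    {π : Measure (Ed d × Ed d)} (hπ : IsCoupling π (empMeas x) ν) :
    ∃ κ : Fin N → Measure (Ed d), (∀ i, IsProbabilityMeasure (κ i)) ∧
      ν = (N : ℝ≥0∞)⁻¹ • ∑ i, κ i ∧
      ∀ f : Ed d × Ed d → ℝ≥0∞, Measurable f →
        ∫⁻ q, f q ∂π = (N : ℝ≥0∞)⁻¹ * ∑ i, ∫⁻ z, f (x i, z) ∂(κ i) := by
  obtain ⟨hπ0, hπ1, hπ2⟩ := hπ
  have hf : ∀ f : Ed d × Ed d → ℝ≥0∞, Measurable f →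
      ∫⁻ q, f q ∂π = (N : ℝ≥0∞)⁻¹ * ∑ i, ∫⁻ z, f (x i, z) ∂(π.condKernel (x i)) := by
    intro f hf
    rw [← Measure.lintegral_condKernel hf, Measure.fst, hπ1, empMeas, lintegral_smul_measure,
      lintegral_finsetSum_measure]
    simp
  refine ⟨fun i => π.condKernel (x i), fun i => inferInstance, ?_, hf⟩
  ext s hs
  rw [← hπ2, Measure.map_apply measurable_snd hs, ← lintegral_indicator_one (measurable_snd hs),
    hf _ (measurable_one.indicator (measurable_snd hs))]
  simp only [Measure.smul_apply, Measure.finsetSum_apply, smul_eq_mul]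
  congr 1
  refine Finset.sum_congr rfl fun i _ => ?_
  rw [← lintegral_indicator_one hs]
  rfl

lemma integrable_sq_and_integral_eq_toReal {E : Type*} [NormedAddCommGroup E]
    [MeasurableSpace E] [BorelSpace E] [SecondCountableTopology E] {μ : Measure E} (x : E)
    (h : ∫⁻ z, (‖x - z‖₊ : ℝ≥0∞) ^ 2 ∂μ ≠ ⊤) :
    Integrable (fun z => ‖x - z‖ ^ 2) μ ∧
      ∫ z, ‖x - z‖ ^ 2 ∂μ = (∫⁻ z, (‖x - z‖₊ : ℝ≥0∞) ^ 2 ∂μ).toReal := by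
  have hm : AEMeasurable (fun z => (‖x - z‖₊ : ℝ≥0∞) ^ 2) μ := by fun_prop
  have he : (fun z => ((‖x - z‖₊ : ℝ≥0∞) ^ 2).toReal) = fun z => ‖x - z‖ ^ 2 := by
    ext z; simp
  rw [← he]
  exact ⟨integrable_toReal_of_lintegral_ne_top hm h,
    integral_toReal hm (Eventually.of_forall fun z => by simp)⟩

lemma d2sq_ne_top {d : ℕ} {μ ν : Measure (Ed d)} (hμ : IsP2 μ) (hν : IsP2 ν) :
    d2sq μ ν ≠ ⊤ := by
  obtain ⟨hμ0, hμ2⟩ := hμ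
  obtain ⟨hν0, hν2⟩ := hν
  have h1 : MemLp (fun q : Ed d × Ed d => q.1) 2 (μ.prod ν) :=
    ((memLp_two_iff_integrable_sq_norm (f := fun z : Ed d => z) (by fun_prop)).2
      hμ2).comp_fst ν
  have h2 : MemLp (fun q : Ed d × Ed d => q.2) 2 (μ.prod ν) :=
    ((memLp_two_iff_integrable_sq_norm (f := fun z : Ed d => z) (by fun_prop)).2
      hν2).comp_snd μ
  have h3 := (memLp_two_iff_integrable_sq_norm (h1.sub h2).aestronglyMeasurable).1 (h1.sub h2)
  have hc : IsCoupling (μ.prod ν) μ ν := ⟨inferInstance, by simp, by simp⟩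
  refine ne_top_of_le_ne_top ?_ (iInf₂_le (μ.prod ν) hc)
  have h4 := h3.hasFiniteIntegral
  rw [HasFiniteIntegral] at h4
  refine ne_of_lt (lt_of_eq_of_lt (lintegral_congr fun q => ?_) h4)
  simp [enorm_eq_nnnorm]

lemma nonneg_of_d1_lipschitz {d : ℕ} (hd : 1 ≤ d) {G : Measure (Ed d) → ℝ} {LG : ℝ}
    (hG : ∀ μ ν : Measure (Ed d), IsP2 μ → IsP2 ν → |G μ - G ν| ≤ LG * d1 μ ν) : 0 ≤ LG := by
  have hdirac : ∀ z : Ed d, IsP2 (Measure.dirac z) := fun z =>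
    ⟨inferInstance, integrable_dirac (by simp)⟩
  set e : Ed d := EuclideanSpace.single ⟨0, hd⟩ 1 with he
  have hen : ‖e‖ = 1 := by simp [he]
  have h1 : 1 ≤ d1 (Measure.dirac e) (Measure.dirac 0) := by
    refine le_csSup ⟨1, ?_⟩ ⟨fun z => ‖z‖, lipschitzWith_one_norm, by simp [hen]⟩
    rintro r ⟨f, hf, rfl⟩
    have h := hf.dist_le_mul e 0
    rw [NNReal.coe_one, one_mul, dist_zero_right, hen, Real.dist_eq] at h
    simpa using (le_abs_self _).trans h
  have h2 := (abs_nonneg _).trans (hG _ _ (hdirac e) (hdirac 0))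
  by_contra! hneg
  nlinarith

lemma bddBelow_NPval {d N : ℕ} (hN : 1 ≤ N) {G : Measure (Ed d) → ℝ} {LG : ℝ} (hLG : 0 ≤ LG)
    (hG : ∀ μ ν : Measure (Ed d), IsP2 μ → IsP2 ν → |G μ - G ν| ≤ LG * d1 μ ν)
    {τ : ℝ} (hτ : 0 < τ) (x : Fin N → Ed d) :
    BddBelow { r | ∃ y : Fin N → Ed d,
      r = G (empMeas y) + (1 / (2 * τ * (N : ℝ))) * ∑ i, ‖x i - y i‖ ^ 2 } := by
  have hN0 : (0 : ℝ) < N := by exact_mod_cast hN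
  refine ⟨G (empMeas x) - LG ^ 2 * τ / 2, ?_⟩
  rintro r ⟨y, rfl⟩
  have h1 : d1 (empMeas x) (empMeas y) ≤ (N : ℝ)⁻¹ * ∑ i, ‖x i - y i‖ := by
    refine d1_le fun f hf => ?_
    rw [integral_empMeas, integral_empMeas, ← mul_sub, ← Finset.sum_sub_distrib]
    refine mul_le_mul_of_nonneg_left (Finset.sum_le_sum fun i _ => ?_) (by positivity)
    have h := hf.dist_le_mul (x i) (y i)
    rw [NNReal.coe_one, one_mul, dist_eq_norm, dist_eq_norm] at h
    exact (Real.le_norm_self _).trans h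
  have h2 := (abs_le.1 (hG _ _ (isP2_empMeas hN x) (isP2_empMeas hN y))).2
  have h3 := mul_le_mul_of_nonneg_left h1 hLG
  have h4 : ∑ i, (LG * ‖x i - y i‖) ≤
      ∑ i, (1 / (2 * τ) * ‖x i - y i‖ ^ 2 + LG ^ 2 * τ / 2) := by
    refine Finset.sum_le_sum fun i _ => ?_
    have h : 1 / (2 * τ) * ‖x i - y i‖ ^ 2 + LG ^ 2 * τ / 2 - LG * ‖x i - y i‖
        = 1 / (2 * τ) * (‖x i - y i‖ - LG * τ) ^ 2 := by
      field_simp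
      ring
    have h' : 0 ≤ 1 / (2 * τ) * (‖x i - y i‖ - LG * τ) ^ 2 := by positivity
    linarith
  rw [Finset.sum_add_distrib, ← Finset.mul_sum, ← Finset.mul_sum] at h4
  simp only [Finset.sum_const, Finset.card_univ, Fintype.card_fin, nsmul_eq_mul] at h4
  have h5 : LG * ((N : ℝ)⁻¹ * ∑ i, ‖x i - y i‖) ≤
      (1 / (2 * τ * (N : ℝ))) * ∑ i, ‖x i - y i‖ ^ 2 + LG ^ 2 * τ / 2 := by
    have h := mul_le_mul_of_nonneg_left h4 (inv_nonneg.2 hN0.le)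
    calc _ = (N : ℝ)⁻¹ * (LG * ∑ i, ‖x i - y i‖) := by ring
      _ ≤ _ := h
      _ = _ := by field_simp
  linarith

lemma rpow_neg_inv_max_le_two_mul_rdN {d N : ℕ} (hN : 1 ≤ N) :
    (N : ℝ) ^ (-(1 / ((max d 4 : ℕ) : ℝ))) ≤ 2 * rdN d N := by
  have hN0 : (0 : ℝ) < N := by exact_mod_cast hN
  unfold rdN
  split_ifs with h1 h2
  · rw [max_eq_right h1.le]
    push_cast
    linarith [Real.rpow_pos_of_pos hN0 (-(1 / 4))]
  · rw [h2, max_self]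
    have hlog : (1 / 4 : ℝ) ≤ Real.log (1 + N) := by
      have h3 : Real.log 2 ≤ Real.log (1 + N) := by
        refine Real.log_le_log (by norm_num) ?_
        have : (1 : ℝ) ≤ N := by exact_mod_cast hN
        linarith
      linarith [Real.log_two_gt_d9]
    have hroot : (1 / 2 : ℝ) ≤ Real.log (1 + N) ^ ((1 : ℝ) / 2) := by
      rw [← Real.sqrt_eq_rpow]
      exact Real.le_sqrt_of_sq_le (by linarith)
    push_cast
    nlinarith [Real.rpow_pos_of_pos hN0 (-(1 / 4))]
  · rw [max_eq_left (by omega)]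
    linarith [Real.rpow_pos_of_pos hN0 (-(1 / (d : ℝ)))]

lemma le_of_forall_pos_le_add_mul {a b c : ℝ} (h : ∀ η > 0, a ≤ b + η * c) : a ≤ b := by
  refine le_of_forall_pos_le_add fun ε hε => ?_
  refine (h (ε / (|c| + 1)) (by positivity)).trans ?_
  have h1 : ε / (|c| + 1) * c ≤ ε / (|c| + 1) * (|c| + 1) := by
    refine mul_le_mul_of_nonneg_left ?_ (by positivity)
    linarith [le_abs_self c]
  rw [div_mul_cancel₀ _ (by positivity)] at h1
  linarith


/-- quantitative convergence rate. For every `p ≥ 5` there is a constant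
`C_{p,d} > 0` depending only on `p` and `d` such that for all `T`, all `d_1`-Lipschitz `G`,
all `N ≥ 1`, `t ∈ [0,T)` and `x ∈ (ℝ^d)^N`,
`V^N(t,x) ≤ U(t, m_x^N) + C_{p,d} L_G (L_G (T-t) + M_p(m_x^N)) r_{d,N}`. -/
theorem nParticleVal_rate_bound {d : ℕ} (hd : 1 ≤ d) :
    ∀ p : ℝ, 5 ≤ p → ∃ C : ℝ, 0 < C ∧
      ∀ T : ℝ, 0 < T →
      ∀ (G : Measure (Ed d) → ℝ) (LG : ℝ),
        (∀ μ ν : Measure (Ed d), IsP2 μ → IsP2 ν → |G μ - G ν| ≤ LG * d1 μ ν) →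
        ∀ N : ℕ, 1 ≤ N → ∀ t : ℝ, 0 ≤ t → t < T → ∀ x : Fin N → Ed d,
          NPval T G t x ≤ MFval T G t (empMeas x)
            + C * LG * (LG * (T - t) + Mp p (empMeas x)) * rdN d N := by

  intro p hp
  have hd0 : (0 : ℝ) < d := by exact_mod_cast hd
  refine ⟨34816 * √d, by positivity, ?_⟩
  intro T hT G LG hG N hN t ht htT x
  have hLG := nonneg_of_d1_lipschitz hd hG
  have hN0 : (0 : ℝ) < N := by exact_mod_cast hN
  have hrate := rpow_neg_inv_max_le_two_mul_rdN (d := d) hN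
  have hM0 := (sum_pow_four_le_Mp hN (by linarith : (4 : ℝ) ≤ p) x le_rfl).1
  set τ := T - t with hτdef
  have hτ : 0 < τ := by rw [hτdef]; linarith
  rw [← sub_le_iff_le_add]
  refine le_csInf ⟨_, empMeas x, isP2_empMeas hN x, rfl⟩ ?_
  rintro r ⟨ν, hν, rfl⟩
  have hfin := d2sq_ne_top (isP2_empMeas hN x) hν
  rw [sub_le_iff_le_add, ← hτdef]
  refine le_of_forall_pos_le_add_mul (c := 1 / (2 * τ) + 34816 * √d * LG * rdN d N)
    fun η hη => ?_
  have hlt : d2sq (empMeas x) ν < d2sq (empMeas x) ν + ENNReal.ofReal η :=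
    ENNReal.lt_add_right hfin (by simpa using hη)
  obtain ⟨π, hπ, hcost⟩ : ∃ π, ∃ _ : IsCoupling π (empMeas x) ν,
      ∫⁻ q, (‖q.1 - q.2‖₊ : ℝ≥0∞) ^ 2 ∂π < d2sq (empMeas x) ν + ENNReal.ofReal η := by
    conv_lhs at hlt => rw [d2sq]
    simpa only [iInf_lt_iff] using hlt
  obtain ⟨κ, hκ0, hκν, hκf⟩ := hπ.exists_average
  rw [hκf _ (by fun_prop)] at hcost
  have hsumtop : ∑ i, ∫⁻ z, (‖x i - z‖₊ : ℝ≥0∞) ^ 2 ∂(κ i) ≠ ⊤ := by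
    intro htop
    simp only [htop] at hcost
    rw [ENNReal.mul_top (by simp)] at hcost
    exact not_top_lt hcost
  have hκi := fun i => integrable_sq_and_integral_eq_toReal (μ := κ i) (x i)
    (ENNReal.sum_ne_top.1 hsumtop i (Finset.mem_univ i))
  have hcost' : (N : ℝ)⁻¹ * ∑ i, ∫ z, ‖x i - z‖ ^ 2 ∂(κ i)
      ≤ (d2sq (empMeas x) ν).toReal + η := by
    have h := ENNReal.toReal_mono (by simp [hfin]) hcost.le
    rw [ENNReal.toReal_mul, ENNReal.toReal_inv, ENNReal.toReal_natCast,
      ENNReal.toReal_sum fun i hi => ENNReal.sum_ne_top.1 hsumtop i hi,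
      ENNReal.toReal_add hfin (by simp), ENNReal.toReal_ofReal hη.le] at h
    simpa only [(hκi _).2] using h
  obtain ⟨y, hy⟩ := exists_particles_cost_le hN (le_max_right d 4) (le_max_left d 4)
    (by linarith : (4 : ℝ) ≤ p) hG hLG hτ (R := LG * τ + η) (by positivity) (by linarith) x κ
    (fun i => (hκi i).1) (hκν ▸ hν)
  rw [← hκν] at hy
  have hle : NPval T G t x ≤
      G (empMeas y) + (1 / (2 * τ * (N : ℝ))) * ∑ i, ‖x i - y i‖ ^ 2 :=
    csInf_le (bddBelow_NPval hN hLG hG hτ x) ⟨y, rfl⟩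
  have h1 : (1 / (2 * τ * (N : ℝ))) * ∑ i, ∫ z, ‖x i - z‖ ^ 2 ∂(κ i)
      ≤ (1 / (2 * τ)) * ((d2sq (empMeas x) ν).toReal + η) := by
    calc _ = (1 / (2 * τ)) * ((N : ℝ)⁻¹ * ∑ i, ∫ z, ‖x i - z‖ ^ 2 ∂(κ i)) := by field_simp
      _ ≤ _ := by gcongr
  have h2 : LG * (17408 * √d * (Mp p (empMeas x) + (LG * τ + η)) *
      (N : ℝ) ^ (-(1 / ((max d 4 : ℕ) : ℝ)))) ≤
      LG * (17408 * √d * (Mp p (empMeas x) + (LG * τ + η)) * (2 * rdN d N)) := by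
    gcongr
  refine hle.trans (hy.trans ?_)
  calc _ ≤ G ν + (1 / (2 * τ)) * ((d2sq (empMeas x) ν).toReal + η) +
        LG * (17408 * √d * (Mp p (empMeas x) + (LG * τ + η)) * (2 * rdN d N)) := by
        linarith
    _ = _ := by ring

end
end

section
/- Let d ≥ 1 and let Leb|_{[0,1]^d} denote the uniform probability measure on the unit cube [0,1]^d ⊂ ℝ^d. There exists a constant c > 0, depending only on d, such that for every N ≥ 1 there exists x ∈ ([0,1]^d)^N with d_2(m_x^N, Leb|_{[0,1]^d})² ≤ c N^{−2/d}. -/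
open MeasureTheory Filter
open scoped ENNReal NNReal BigOperators

noncomputable section

/-- The unit cube `[0,1]^d ⊂ ℝ^d`. -/
def unitCube (d : ℕ) : Set (Ed d) := {z | ∀ i, z i ∈ Set.Icc (0 : ℝ) 1}

/-- The uniform (Lebesgue) probability measure on the unit cube `[0,1]^d`. -/
def unifCube (d : ℕ) : Measure (Ed d) := volume.restrict (unitCube d)

/-- The interval `(0, ∑ j, w j]` is cut into consecutive pieces of lengths `w j`. -/
lemma sum_restrict_Ioc_partialSums (w : ℕ → ℝ) (hw : ∀ j, 0 ≤ w j) (k : ℕ) :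
    ∑ j ∈ Finset.range k, (volume : Measure ℝ).restrict
        (Set.Ioc (∑ l ∈ Finset.range j, w l) (∑ l ∈ Finset.range (j + 1), w l)) =
      volume.restrict (Set.Ioc 0 (∑ l ∈ Finset.range k, w l)) := by
  induction k with
  | zero => simp
  | succ k ih =>
    rw [Finset.sum_range_succ, ih, ← Measure.restrict_union _ measurableSet_Ioc,
      Set.Ioc_union_Ioc_eq_Ioc]
    · exact Finset.sum_nonneg fun j _ => hw j
    · exact Finset.sum_le_sum_of_subset_of_nonneg
        (Finset.range_subset_range.2 k.le_succ) fun j _ _ => hw j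
    · exact Set.Ioc_disjoint_Ioc_of_le le_rfl

/-- The uniform measure on `[0,1]` splits into pieces of prescribed masses `w j`, each
concentrated within distance `w j` of a point of `[0,1]`. -/
lemma exists_split_unitInterval {k : ℕ} (w : Fin k → ℝ) (hw : ∀ j, 0 ≤ w j)
    (hw1 : ∑ j, w j = 1) :
    ∃ (ρ : Fin k → Measure ℝ) (p : Fin k → ℝ),
      (∀ j, p j ∈ Set.Icc (0 : ℝ) 1) ∧ (∀ j, ρ j Set.univ = ENNReal.ofReal (w j)) ∧
      ∑ j, ρ j = volume.restrict (Set.Icc 0 1) ∧ ∀ j, ∀ᵐ s ∂ρ j, |s - p j| ≤ w j := by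
  set v : ℕ → ℝ := fun j => if h : j < k then w ⟨j, h⟩ else 0 with hv
  have hvw (j : Fin k) : v j = w j := by simp [hv]
  have hv0 (j : ℕ) : 0 ≤ v j := by
    simp only [hv]; split_ifs
    · exact hw _
    · exact le_rfl
  set a : ℕ → ℝ := fun j => ∑ l ∈ Finset.range j, v l with ha
  have hak : a k = 1 := by
    simp_rw [ha, ← hw1, ← Fin.sum_univ_eq_sum_range, hvw]
  have ha_succ (j : ℕ) : a (j + 1) = a j + v j := Finset.sum_range_succ _ _
  have ha_mono : Monotone a := monotone_nat_of_le_succ fun j => by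
    rw [ha_succ]; linarith [hv0 j]
  refine ⟨fun j => volume.restrict (Set.Ioc (a j) (a (j + 1))), fun j => a j, fun j => ⟨?_, ?_⟩,
    fun j => ?_, ?_, fun j => ?_⟩
  · exact Finset.sum_nonneg fun l _ => hv0 l
  · exact (ha_mono j.2.le).trans hak.le
  · simp [ha_succ, hvw]
  · rw [Fin.sum_univ_eq_sum_range (fun j => volume.restrict (Set.Ioc (a j) (a (j + 1)))),
      sum_restrict_Ioc_partialSums v hv0 k, restrict_Ioc_eq_restrict_Icc]
    change volume.restrict (Set.Icc 0 (a k)) = _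
    rw [hak]
  · refine (ae_restrict_iff' measurableSet_Ioc).2 (ae_of_all _ fun s hs => ?_)
    rw [← hvw, abs_of_nonneg (by linarith [hs.1])]
    linarith [hs.2, ha_succ j]

/-- A finite type can be split into `k` classes of nearly equal sizes. -/
lemma exists_balanced_map {ι : Type} [Fintype ι] {k : ℕ} (hk : 0 < k) :
    ∃ f : ι → Fin k, ∀ j, Fintype.card ι / k ≤ Fintype.card {i // f i = j} ∧
      Fintype.card {i // f i = j} ≤ Fintype.card ι / k + 1 := by
  refine ⟨fun i => ⟨Fintype.equivFin ι i % k, Nat.mod_lt _ hk⟩, fun j => ?_⟩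
  have key : Fintype.card {i // (⟨Fintype.equivFin ι i % k, Nat.mod_lt _ hk⟩ : Fin k) = j} =
      (Fintype.card ι).count (· ≡ j [MOD k]) := by
    rw [Nat.count_eq_card_filter_range, Finset.card_filter,
      ← Fin.sum_univ_eq_sum_range (fun a => if a ≡ j [MOD k] then 1 else 0), ← Finset.card_filter,
      ← Fintype.card_subtype]
    refine Fintype.card_congr ((Fintype.equivFin ι).subtypeEquiv fun i => ?_)
    simp [Fin.ext_iff, Nat.ModEq, Nat.mod_eq_of_lt j.2]
  rw [key, Nat.count_modEq_card _ hk]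
  split_ifs <;> omega

/-- The uniform measure on `[0,1]^d` splits into at least `k ^ d` pieces of equal mass, each
concentrated in a cube of half-side `2 / k` around a point of `[0,1]^d`. -/
lemma exists_split_cube (d : ℕ) {k : ℕ} (hk : 0 < k) {ι : Type} [Fintype ι]
    (hι : k ^ d ≤ Fintype.card ι) :
    ∃ (μ : ι → Measure (Fin d → ℝ)) (x : ι → Fin d → ℝ),
      (∀ i l, x i l ∈ Set.Icc (0 : ℝ) 1) ∧
      (∀ i, μ i Set.univ = (Fintype.card ι : ℝ≥0∞)⁻¹) ∧
      ∑ i, μ i = Measure.pi (fun _ => volume.restrict (Set.Icc (0 : ℝ) 1)) ∧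
      ∀ i, ∀ᵐ y ∂μ i, ∀ l, |y l - x i l| ≤ 2 / k := by
  induction d generalizing ι with
  | zero =>
    have hn : (Fintype.card ι : ℝ≥0∞) ≠ 0 := by
      simp only [pow_zero] at hι; exact_mod_cast (by omega : Fintype.card ι ≠ 0)
    refine ⟨fun _ => (Fintype.card ι : ℝ≥0∞)⁻¹ •
      Measure.pi (fun _ => volume.restrict (Set.Icc (0 : ℝ) 1)), fun _ => 0,
      fun _ l => l.elim0, fun _ => ?_, ?_, fun _ => ae_of_all _ fun _ l => l.elim0⟩
    · simp
    · rw [Finset.sum_const, Finset.card_univ, ← Nat.cast_smul_eq_nsmul ℝ≥0∞, smul_smul,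
        ENNReal.mul_inv_cancel hn (ENNReal.natCast_ne_top _), one_smul]
  | succ d ih =>
    set n := Fintype.card ι with hn
    have hkn : k ≤ n := (Nat.le_self_pow d.succ_ne_zero k).trans hι
    obtain ⟨f, hf⟩ := exists_balanced_map (ι := ι) hk
    set m : Fin k → ℕ := fun j => Fintype.card {i // f i = j} with hm
    have hmk (j : Fin k) : k ^ d ≤ m j :=
      ((Nat.le_div_iff_mul_le hk).2 (by rwa [← pow_succ])).trans (hf j).1
    have hm0 (j : Fin k) : 0 < m j := (pow_pos hk d).trans_le (hmk j)
    have hn0 : (0 : ℝ) < n := by exact_mod_cast hk.trans_le hkn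
    have hk0 : (0 : ℝ) < k := by exact_mod_cast hk
    choose ν x hx hν hsum hae using fun j => ih (ι := {i // f i = j}) (hmk j)
    have hmsum : ∑ j, m j = n := by
      rw [hn, ← Fintype.card_sigma]
      exact Fintype.card_congr (Equiv.sigmaFiberEquiv f)
    obtain ⟨ρ, p, hp, hρ, hρsum, hρae⟩ := exists_split_unitInterval
      (fun j => (m j : ℝ) / n) (fun j => by positivity) (by
        rw [← Finset.sum_div, ← Nat.cast_sum, hmsum, div_self hn0.ne'])
    have hwk (j : Fin k) : (m j : ℝ) / n ≤ 2 / k := by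
      have h1 : (m j : ℝ) ≤ n / k + 1 := by
        have : (m j : ℝ) ≤ ((n / k : ℕ) : ℝ) + 1 := by exact_mod_cast (hf j).2
        linarith [Nat.cast_div_le (α := ℝ) (m := n) (n := k)]
      have h2 : (1 : ℝ) ≤ n / k := (one_le_div hk0).2 (by exact_mod_cast hkn)
      rw [div_le_iff₀ hn0]
      calc (m j : ℝ) ≤ n / k + n / k := by linarith
        _ = 2 / k * n := by ring
    have hρfin (j : Fin k) : IsFiniteMeasure (ρ j) := ⟨by rw [hρ]; exact ENNReal.ofReal_lt_top⟩
    have hνfin (j : Fin k) (i : {i // f i = j}) : IsFiniteMeasure (ν j i) := ⟨by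
      rw [hν]; exact ENNReal.inv_lt_top.2 (by exact_mod_cast hm0 j)⟩
    let e := (MeasurableEquiv.piFinSuccAbove (fun _ : Fin (d + 1) => ℝ) 0).symm
    have he (q : ℝ × (Fin d → ℝ)) : e q = Fin.cons q.1 q.2 :=
      Fin.insertNth_zero' _ _
    refine ⟨fun i => ((ρ (f i)).prod (ν (f i) ⟨i, rfl⟩)).map e,
      fun i => Fin.cons (p (f i)) (x (f i) ⟨i, rfl⟩), fun i l => ?_, fun i => ?_, ?_, fun i => ?_⟩
    · refine Fin.cases ?_ (fun l => ?_) l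
      · exact hp _
      · exact hx _ _ l
    · rw [Measure.map_apply e.measurable MeasurableSet.univ, Set.preimage_univ,
        ← Set.univ_prod_univ, Measure.prod_prod, hρ, hν, ENNReal.ofReal_div_of_pos hn0,
        ENNReal.ofReal_natCast, ENNReal.ofReal_natCast, div_eq_mul_inv, mul_right_comm,
        ENNReal.mul_inv_cancel (by exact_mod_cast (hm0 (f i)).ne') (ENNReal.natCast_ne_top _),
        one_mul]
    · rw [← Fintype.sum_fiberwise f]
      have hfib (j : Fin k) (i : {i // f i = j}) :
          ((ρ (f i)).prod (ν (f i) ⟨i, rfl⟩)).map e = ((ρ j).prod (ν j i)).map e := by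
        obtain ⟨i, rfl⟩ := i; rfl
      simp_rw [hfib]
      have hprod (j : Fin k) : ∑ i, ((ρ j).prod (ν j i)).map e =
          ((ρ j).prod (Measure.pi fun _ => volume.restrict (Set.Icc (0 : ℝ) 1))).map e := by
        rw [← hsum j, ← Measure.sum_fintype, ← Measure.sum_fintype, Measure.prod_sum_right,
          Measure.map_sum e.measurable.aemeasurable]
      simp_rw [hprod]
      rw [← Measure.sum_fintype, ← Measure.map_sum e.measurable.aemeasurable,
        ← Measure.prod_sum_left, Measure.sum_fintype, hρsum]
      exact ((measurePreserving_piFinSuccAbove (fun _ : Fin (d + 1) =>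
        volume.restrict (Set.Icc (0 : ℝ) 1)) 0).symm _).map_eq
    · rw [e.measurableEmbedding.ae_map_iff]
      filter_upwards [Measure.quasiMeasurePreserving_fst.ae (hρae (f i)),
        Measure.quasiMeasurePreserving_snd.ae (hae (f i) ⟨i, rfl⟩)] with q h1 h2 l
      rw [he]
      refine Fin.cases ?_ (fun l => ?_) l
      · exact h1.trans (hwk _)
      · exact h2 l

/-- The uniform measure on the cube is the product of uniform measures on `[0,1]`. -/
lemma unifCube_eq_map_pi (d : ℕ) :
    unifCube d = (Measure.pi fun _ => volume.restrict (Set.Icc (0 : ℝ) 1)).map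
      (MeasurableEquiv.toLp 2 (Fin d → ℝ)) := by
  have hpre : (MeasurableEquiv.toLp 2 (Fin d → ℝ)) ⁻¹' unitCube d =
      Set.univ.pi fun _ => Set.Icc (0 : ℝ) 1 := by
    ext y; simp [unitCube, -Set.pi_univ_Icc]
  rw [← Measure.restrict_pi_pi, ← hpre, ← (MeasurableEquiv.toLp 2 _).restrict_map]
  exact congrArg (Measure.restrict · _) (PiLp.volume_preserving_toLp (Fin d)).map_eq.symm

/-- If `ν` splits into `N` pieces of equal mass, the `i`-th one concentrated where
`|x i - y|² ≤ r`, then `d_2(m_x^N, ν)² ≤ r`. -/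
lemma d2sq_empMeas_le {d N : ℕ} (hN : N ≠ 0) {x : Fin N → Ed d} {μ : Fin N → Measure (Ed d)}
    {ν : Measure (Ed d)} {r : ℝ} (hμ : ∀ i, μ i Set.univ = (N : ℝ≥0∞)⁻¹) (hν : ∑ i, μ i = ν)
    (hr : ∀ i, ∀ᵐ y ∂μ i, ‖x i - y‖ ^ 2 ≤ r) :
    d2sq (empMeas x) ν ≤ ENNReal.ofReal r := by
  have hmeas (i : Fin N) : Measurable fun y : Ed d => (x i, y) := measurable_prodMk_left
  have hmass : ∑ _i : Fin N, (N : ℝ≥0∞)⁻¹ = 1 := by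
    rw [Finset.sum_const, Finset.card_univ, Fintype.card_fin, nsmul_eq_mul]
    exact ENNReal.mul_inv_cancel (by exact_mod_cast hN) (ENNReal.natCast_ne_top _)
  have hcoupling : IsCoupling (∑ i, (μ i).map fun y => (x i, y)) (empMeas x) ν := by
    refine ⟨⟨?_⟩, ?_, ?_⟩
    · simp [Measure.finsetSum_apply, Measure.map_apply (hmeas _), hμ, hmass]
    · rw [← Measure.sum_fintype, Measure.map_sum measurable_fst.aemeasurable, Measure.sum_fintype,
        empMeas, Finset.smul_sum]
      refine Finset.sum_congr rfl fun i _ => ?_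
      rw [Measure.map_map measurable_fst (hmeas i), ← hμ i, ← Measure.map_const]
      rfl
    · rw [← Measure.sum_fintype, Measure.map_sum measurable_snd.aemeasurable, Measure.sum_fintype,
        ← hν]
      refine Finset.sum_congr rfl fun i _ => ?_
      rw [Measure.map_map measurable_snd (hmeas i)]
      exact Measure.map_id
  have hle : d2sq (empMeas x) ν ≤ ∫⁻ p, (‖p.1 - p.2‖₊ : ℝ≥0∞) ^ 2
      ∂(∑ i, (μ i).map fun y => (x i, y)) :=
    iInf_le_of_le _ (iInf_le _ hcoupling)
  refine hle.trans ?_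
  rw [lintegral_finsetSum_measure]
  calc ∑ i, ∫⁻ p, (‖p.1 - p.2‖₊ : ℝ≥0∞) ^ 2 ∂(μ i).map (fun y => (x i, y))
      ≤ ∑ _i : Fin N, ENNReal.ofReal r * (N : ℝ≥0∞)⁻¹ := by
        refine Finset.sum_le_sum fun i _ => ?_
        rw [lintegral_map (by fun_prop) (hmeas i), ← hμ i, ← lintegral_const]
        refine lintegral_mono_ae ((hr i).mono fun y hy => ?_)
        rw [← enorm_eq_nnnorm, ← ofReal_norm, ← ENNReal.ofReal_pow (norm_nonneg _)]
        exact ENNReal.ofReal_le_ofReal hy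
    _ = ENNReal.ofReal r := by rw [← Finset.mul_sum, hmass, mul_one]

/-- quantization of the uniform measure on the cube: there is `c > 0`,
depending only on `d`, such that for every `N ≥ 1` there is `x ∈ ([0,1]^d)^N` with
`d_2(m_x^N, Leb|_{[0,1]^d})² ≤ c N^{-2/d}`. -/
theorem cube_quantization {d : ℕ} (hd : 1 ≤ d) :
    ∃ c : ℝ, 0 < c ∧ ∀ N : ℕ, 1 ≤ N → ∃ x : Fin N → Ed d,
      (∀ i, x i ∈ unitCube d) ∧
      (d2sq (empMeas x) (unifCube d)).toReal ≤ c * (N : ℝ) ^ (-(2 / (d : ℝ))) := by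
  have hd0 : (0 : ℝ) < d := by exact_mod_cast hd
  refine ⟨d * 16, by positivity, fun N hN => ?_⟩
  have hN0 : (0 : ℝ) < N := by exact_mod_cast hN
  set t : ℝ := (N : ℝ) ^ (1 / (d : ℝ)) with ht
  have ht1 : 1 ≤ t := Real.one_le_rpow (by exact_mod_cast hN) (by positivity)
  set k := ⌊t⌋₊ with hkdef
  have hk : 0 < k := Nat.floor_pos.2 ht1
  have hk0 : (0 : ℝ) < k := by exact_mod_cast hk
  have hk1 : (1 : ℝ) ≤ k := by exact_mod_cast hk
  have hkt : (k : ℝ) ≤ t := Nat.floor_le (by positivity)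
  have htk : t ≤ 2 * k := by linarith [Nat.lt_floor_add_one t]
  have hcard : k ^ d ≤ Fintype.card (Fin N) := by
    have h : (k : ℝ) ^ d ≤ N := by
      calc (k : ℝ) ^ d ≤ t ^ d := by gcongr
        _ = N := by rw [ht, one_div, Real.rpow_inv_natCast_pow hN0.le (by omega)]
    rw [Fintype.card_fin]
    exact_mod_cast h
  have htN : (N : ℝ) ^ (-(2 / (d : ℝ))) = (t ^ 2)⁻¹ := by
    rw [Real.rpow_neg hN0.le, ht, ← Real.rpow_natCast, ← Real.rpow_mul hN0.le]
    congr 2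
    push_cast
    ring
  obtain ⟨μ, x, hx, hμ, hsum, hae⟩ := exists_split_cube d hk hcard
  let e := MeasurableEquiv.toLp 2 (Fin d → ℝ)
  refine ⟨fun i => e (x i), fun i l => hx i l, ?_⟩
  have hle : d2sq (empMeas fun i => e (x i)) (unifCube d) ≤
      ENNReal.ofReal (d * (2 / k) ^ 2) := by
    refine d2sq_empMeas_le (μ := fun i => (μ i).map e) (by omega) (fun i => ?_) ?_ fun i => ?_
    · rw [Measure.map_apply e.measurable MeasurableSet.univ, Set.preimage_univ, hμ,
        Fintype.card_fin]
    · rw [unifCube_eq_map_pi, ← hsum, ← Measure.sum_fintype, ← Measure.sum_fintype,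
        Measure.map_sum e.measurable.aemeasurable]
    · rw [e.measurableEmbedding.ae_map_iff]
      filter_upwards [hae i] with y hy
      rw [EuclideanSpace.norm_sq_eq]
      calc ∑ l, ‖(e (x i) - e y) l‖ ^ 2 ≤ ∑ _l : Fin d, (2 / (k : ℝ)) ^ 2 := by
            refine Finset.sum_le_sum fun l _ => ?_
            have h : ‖(e (x i) - e y) l‖ = |y l - x i l| := abs_sub_comm _ _
            rw [h]
            gcongr
            exact hy l
        _ = d * (2 / k) ^ 2 := by simp
  calc (d2sq (empMeas fun i => e (x i)) (unifCube d)).toReal ≤ d * (2 / k) ^ 2 :=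
        ENNReal.toReal_le_of_le_ofReal (by positivity) hle
    _ ≤ d * (4 / t) ^ 2 := by
        have : (2 : ℝ) / k ≤ 4 / t := by
          rw [div_le_div_iff₀ hk0 (by linarith)]
          linarith
        gcongr
    _ = d * 16 * (N : ℝ) ^ (-(2 / (d : ℝ))) := by
        rw [htN]
        ring

end
end

section
/- Let d ≥ 1, T ≥ 1/2 and set t_0 := T − 1/2. Take G(m) := d_1(m, Leb|_{[0,1]^d}), where Leb|_{[0,1]^d} is the uniform probability measure on the unit cube [0,1]^d. Then there exists m_0 ∈ P_2(ℝ^d) such that U(t_0, m_0) < Ũ(t_0, m_0); that is, restricting to controls that are functions of time and the initial condition only strictly increases the value. -/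
open MeasureTheory Filter
open scoped ENNReal NNReal BigOperators

noncomputable section

/-- The value `Ũ(t_0, m_0)` of the deterministic mean-field control problem restricted to
controls that are measurable functions of time and the initial condition only. -/
def Utilde {d : ℕ} (T : ℝ) (G : Measure (Ed d) → ℝ) (t0 : ℝ) (m0 : Measure (Ed d)) : ℝ :=
  sInf { r : ℝ | ∃ α : ℝ → Ed d → Ed d,
    Measurable (Function.uncurry α) ∧
    (∫⁻ t in Set.Ioc t0 T, ∫⁻ ξ, (‖α t ξ‖₊ : ℝ≥0∞) ^ 2 ∂m0) < ⊤ ∧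
    r = (∫ t in t0..T, ∫ ξ, (1 / 2) * ‖α t ξ‖ ^ 2 ∂m0)
        + G (m0.map fun ξ => ξ + ∫ t in t0..T, α t ξ) }

theorem isClosed_unitCube (d : ℕ) : IsClosed (unitCube d) := by
  simp only [unitCube, Set.ofPred_forall]
  exact isClosed_iInter fun i => isClosed_Icc.preimage (by fun_prop)

theorem isCompact_unitCube (d : ℕ) : IsCompact (unitCube d) := by
  have h : IsCompact (Set.univ.pi fun _ : Fin d => Set.Icc (0 : ℝ) 1) :=
    isCompact_univ_pi fun _ => isCompact_Icc
  have h' := h.image (PiLp.continuous_toLp 2 (fun _ : Fin d => ℝ))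
  convert h' using 1
  ext z
  constructor
  · exact fun hz => ⟨fun i => z i, fun i _ => hz i, rfl⟩
  · rintro ⟨w, hw, rfl⟩ i
    exact hw i trivial

instance isProbabilityMeasure_unifCube (d : ℕ) : IsProbabilityMeasure (unifCube d) := by
  constructor
  have h := (PiLp.volume_preserving_toLp (Fin d)).measure_preimage
    (isClosed_unitCube d).measurableSet.nullMeasurableSet
  have h2 : (WithLp.toLp 2 ⁻¹' unitCube d : Set (Fin d → ℝ)) = Set.Icc 0 1 := by
    ext z
    simp [unitCube, Set.mem_Icc, Pi.le_def, forall_and]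
  rw [unifCube, Measure.restrict_apply_univ, ← h, h2, Real.volume_Icc_pi]
  simp

theorem Continuous.integrable_unifCube {d : ℕ} {f : Ed d → ℝ} (hf : Continuous f) :
    Integrable f (unifCube d) :=
  hf.continuousOn.integrableOn_compact (isCompact_unitCube d)

/-- The centre of the unit cube. -/
def cubeCenter (d : ℕ) : Ed d := WithLp.toLp 2 fun _ => 1 / 2

theorem measurePreserving_reflect_unifCube (d : ℕ) :
    MeasurePreserving (fun z : Ed d => (2 : ℝ) • cubeCenter d - z) (unifCube d) (unifCube d) := by
  have h := (Measure.measurePreserving_sub_left (volume : Measure (Ed d))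
    ((2 : ℝ) • cubeCenter d)).restrict_preimage (isClosed_unitCube d).measurableSet
  have h2 : (fun z : Ed d => (2 : ℝ) • cubeCenter d - z) ⁻¹' unitCube d = unitCube d := by
    ext z
    refine forall_congr' fun i => ?_
    simp only [cubeCenter, PiLp.sub_apply, PiLp.smul_apply, smul_eq_mul, Set.mem_Icc]
    constructor <;> rintro ⟨h0, h1⟩ <;> constructor <;> linarith
  rwa [h2] at h

theorem integral_norm_sub_cubeCenter_le {d : ℕ} (y : Ed d) :
    ∫ z, ‖z - cubeCenter d‖ ∂unifCube d ≤ ∫ z, ‖z - y‖ ∂unifCube d := by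
  set c := cubeCenter d
  have hsymm : ∫ z, ‖(2 : ℝ) • c - z - y‖ ∂unifCube d = ∫ z, ‖z - y‖ ∂unifCube d := by
    have h := measurePreserving_reflect_unifCube d
    have := integral_map (μ := unifCube d) h.measurable.aemeasurable (f := fun z => ‖z - y‖)
      (by fun_prop)
    rw [h.map_eq] at this
    exact this.symm
  have h1 : Integrable (fun z => ‖(2 : ℝ) • c - z - y‖) (unifCube d) :=
    Continuous.integrable_unifCube (by fun_prop)
  have h2 : Integrable (fun z => ‖z - y‖) (unifCube d) :=
    Continuous.integrable_unifCube (by fun_prop)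
  have h3 : Integrable (fun z => ‖z - c‖) (unifCube d) :=
    Continuous.integrable_unifCube (by fun_prop)
  have key : ∫ z, 2 * ‖z - c‖ ∂unifCube d
      ≤ ∫ z, (‖z - y‖ + ‖(2 : ℝ) • c - z - y‖) ∂unifCube d := by
    refine integral_mono (h3.const_mul 2) (h2.add h1) fun z => ?_
    calc 2 * ‖z - c‖ = ‖(2 : ℝ) • (z - c)‖ := by simp [norm_smul]
      _ = ‖(z - y) - ((2 : ℝ) • c - z - y)‖ := by
        congr 1
        module
      _ ≤ _ := norm_sub_le _ _
  rw [integral_const_mul, integral_add h2 h1, hsymm] at key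
  linarith

theorem integral_norm_sub_pos {d : ℕ} (hd : 1 ≤ d) (y : Ed d) :
    0 < ∫ z, ‖z - y‖ ∂unifCube d := by
  have : Nonempty (Fin d) := ⟨⟨0, hd⟩⟩
  rw [integral_pos_iff_support_of_nonneg (fun _ => norm_nonneg _)
    (Continuous.integrable_unifCube (by fun_prop))]
  have h : Function.support (fun z : Ed d => ‖z - y‖) = {y}ᶜ := by
    ext z
    simp [sub_eq_zero]
  rw [h, prob_compl_eq_one_sub (measurableSet_singleton y)]
  simp [unifCube]

theorem d1_nonneg {d : ℕ} (μ ν : Measure (Ed d)) : 0 ≤ d1 μ ν :=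
  Real.sSup_nonneg' ⟨0, ⟨0, LipschitzWith.const' 0, by simp⟩, le_rfl⟩

theorem le_d1_dirac {d : ℕ} (y : Ed d) :
    ∫ z, ‖z - y‖ ∂unifCube d ≤ d1 (Measure.dirac y) (unifCube d) := by
  refine le_csSup ⟨∫ z, ‖z - y‖ ∂unifCube d, ?_⟩ ⟨fun z => -‖z - y‖, ?_, ?_⟩
  · rintro _ ⟨f, hf, rfl⟩
    have hfy : f y = ∫ _, f y ∂unifCube d := by simp
    rw [integral_dirac, hfy, ← integral_sub (integrable_const _)
      hf.continuous.integrable_unifCube]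
    refine integral_mono ((integrable_const _).sub hf.continuous.integrable_unifCube)
      (Continuous.integrable_unifCube (by fun_prop)) fun z => ?_
    have := hf.dist_le_mul y z
    rw [Real.dist_eq, dist_eq_norm, norm_sub_rev] at this
    simpa using (le_abs_self _).trans this
  · exact (LipschitzWith.of_dist_le_mul fun a b => by
      simpa [dist_eq_norm] using abs_norm_sub_norm_le (a - y) (b - y)).neg
  · simp [integral_neg]

theorem d1_map_le {d : ℕ} {p : Ed d → Ed d} (hp : Continuous p) :
    d1 ((unifCube d).map p) (unifCube d) ≤ ∫ z, ‖p z - z‖ ∂unifCube d := by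
  refine csSup_le ⟨0, 0, LipschitzWith.const' 0, by simp⟩ ?_
  rintro _ ⟨f, hf, rfl⟩
  have hfc := hf.continuous
  have h1 : Integrable (fun z => f (p z)) (unifCube d) := (hfc.comp hp).integrable_unifCube
  rw [integral_map hp.aemeasurable hfc.aestronglyMeasurable]
  rw [← integral_sub h1 hfc.integrable_unifCube]
  refine integral_mono (h1.sub hfc.integrable_unifCube)
    (Continuous.integrable_unifCube (by fun_prop)) fun z => ?_
  have := hf.dist_le_mul (p z) z
  rw [Real.dist_eq, dist_eq_norm] at this
  simpa using (le_abs_self _).trans this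

theorem d2sq_dirac_map_le {d : ℕ} (x : Ed d) {p : Ed d → Ed d} (hp : Continuous p) :
    (d2sq (Measure.dirac x) ((unifCube d).map p)).toReal ≤ ∫ z, ‖p z - x‖ ^ 2 ∂unifCube d := by
  have hm : Measurable fun z => (x, p z) := by fun_prop
  have hπ : IsCoupling ((unifCube d).map fun z => (x, p z)) (Measure.dirac x)
      ((unifCube d).map p) := by
    refine ⟨Measure.isProbabilityMeasure_map hm.aemeasurable, ?_, ?_⟩
    · rw [Measure.map_map measurable_fst hm]
      simp [Function.comp_def]
    · rw [Measure.map_map measurable_snd hm]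
      rfl
  refine ENNReal.toReal_le_of_le_ofReal (integral_nonneg fun z => by positivity) ?_
  refine (iInf₂_le (f := fun (π : Measure (Ed d × Ed d))
    (_ : IsCoupling π (Measure.dirac x) ((unifCube d).map p)) =>
      ∫⁻ q, (‖q.1 - q.2‖₊ : ℝ≥0∞) ^ 2 ∂π) _ hπ).trans_eq ?_
  rw [lintegral_map (by fun_prop) hm, ofReal_integral_eq_lintegral_ofReal
    (Continuous.integrable_unifCube (by fun_prop)) (ae_of_all _ fun z => by positivity)]
  refine lintegral_congr fun z => ?_
  rw [ENNReal.ofReal_pow (norm_nonneg _), ofReal_norm, ← enorm_eq_nnnorm,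
    ← enorm_neg, neg_sub]

theorem isP2_map {d : ℕ} {p : Ed d → Ed d} (hp : Continuous p) :
    IsP2 ((unifCube d).map p) := by
  refine ⟨Measure.isProbabilityMeasure_map hp.aemeasurable, ?_⟩
  rw [integrable_map_measure (by fun_prop) hp.aemeasurable]
  exact Continuous.integrable_unifCube (by fun_prop)

theorem MFval_dirac_cubeCenter_lt {d : ℕ} (hd : 1 ≤ d) (T : ℝ) :
    MFval T (fun m => d1 m (unifCube d)) (T - 1 / 2) (Measure.dirac (cubeCenter d))
      < ∫ z, ‖z - cubeCenter d‖ ∂unifCube d := by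
  set c := cubeCenter d
  have hA := integral_norm_sub_pos hd c
  set A := ∫ z, ‖z - c‖ ∂unifCube d with hA'
  set B := ∫ z, ‖z - c‖ ^ 2 ∂unifCube d with hB'
  have hB : 0 ≤ B := integral_nonneg fun z => by positivity
  obtain ⟨ε, hε0, hε1, hεB⟩ : ∃ ε : ℝ, 0 < ε ∧ ε ≤ 1 ∧ ε * B < A := by
    refine ⟨A / (A + B + 1), by positivity, ?_, ?_⟩
    · rw [div_le_one (by positivity)]
      linarith
    · rw [div_mul_eq_mul_div, div_lt_iff₀ (by positivity)]
      nlinarith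
  set p : Ed d → Ed d := fun z => c + ε • (z - c) with hp'
  have hp : Continuous p := by fun_prop
  have h1 : ∫ z, ‖p z - z‖ ∂unifCube d = (1 - ε) * A := by
    rw [hA', ← integral_const_mul]
    refine integral_congr_ae (ae_of_all _ fun z => ?_)
    have : p z - z = -((1 - ε) • (z - c)) := by
      simp only [hp']
      module
    simp only [this, norm_neg, norm_smul, Real.norm_of_nonneg (sub_nonneg.2 hε1)]
  have h2 : ∫ z, ‖p z - c‖ ^ 2 ∂unifCube d = ε ^ 2 * B := by
    rw [hB', ← integral_const_mul]
    refine integral_congr_ae (ae_of_all _ fun z => ?_)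
    simp [hp', norm_smul, mul_pow]
  have hbdd : BddBelow { r | ∃ ν : Measure (Ed d), IsP2 ν ∧ r = d1 ν (unifCube d)
      + (d2sq (Measure.dirac c) ν).toReal / (2 * (T - (T - 1 / 2))) } := by
    refine ⟨0, ?_⟩
    rintro _ ⟨ν, -, rfl⟩
    have hT : 2 * (T - (T - 1 / 2)) = 1 := by ring
    rw [hT]
    exact add_nonneg (d1_nonneg _ _) (by positivity)
  refine (csInf_le hbdd ⟨_, isP2_map hp, rfl⟩).trans_lt ?_
  have hT : 2 * (T - (T - 1 / 2)) = 1 := by ring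
  rw [hT, div_one]
  have h3 := d1_map_le hp
  have h4 := d2sq_dirac_map_le c hp
  rw [h1] at h3
  rw [h2] at h4
  nlinarith

theorem le_Utilde_dirac {d : ℕ} (T : ℝ) (x : Ed d) :
    ∫ z, ‖z - cubeCenter d‖ ∂unifCube d
      ≤ Utilde T (fun m => d1 m (unifCube d)) (T - 1 / 2) (Measure.dirac x) := by
  have hT : T - 1 / 2 ≤ T := by linarith
  refine le_csInf ⟨_, 0, measurable_const, by simp, rfl⟩ ?_
  rintro _ ⟨α, hα, -, rfl⟩
  have hm : Measurable fun ξ => ξ + ∫ t in (T - 1 / 2)..T, α t ξ := by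
    simp only [intervalIntegral.integral_of_le hT]
    exact measurable_id.add hα.stronglyMeasurable.integral_prod_left.measurable
  simp only [Measure.map_dirac' hm]
  have h0 : 0 ≤ ∫ t in (T - 1 / 2)..T, ∫ ξ, (1 / 2) * ‖α t ξ‖ ^ 2 ∂Measure.dirac x :=
    intervalIntegral.integral_nonneg hT fun t _ => integral_nonneg fun ξ => by positivity
  linarith [le_d1_dirac (x + ∫ t in (T - 1 / 2)..T, α t x),
    integral_norm_sub_cubeCenter_le (x + ∫ t in (T - 1 / 2)..T, α t x)]

/-- with `G(m) = d_1(m, Leb|_{[0,1]^d})` and `t_0 = T - 1/2`, there is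
`m_0 ∈ P_2(ℝ^d)` with `U(t_0, m_0) < Ũ(t_0, m_0)`: restricting to controls that are functions
of time and the initial condition only strictly increases the value. -/
theorem mfVal_lt_Utilde {d : ℕ} (hd : 1 ≤ d) (T : ℝ) (hT : 1 / 2 ≤ T) :
    ∃ m0 : Measure (Ed d), IsP2 m0 ∧
      MFval T (fun m => d1 m (unifCube d)) (T - 1 / 2) m0
        < Utilde T (fun m => d1 m (unifCube d)) (T - 1 / 2) m0 := by
  refine ⟨Measure.dirac (cubeCenter d), ⟨inferInstance, ?_⟩,
    (MFval_dirac_cubeCenter_lt hd T).trans_le (le_Utilde_dirac T _)⟩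
  exact integrable_dirac (by simp)

end
end
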